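/- arXiv:2501.01358 — 3 statements merged into one kernel-verified Lean document; each statement's English description precedes it below -/
import Mathlib

section
/- Let n ≥ 2 and D > 0. There exists a constant C > 0 depending only on n and D such that the following holds: for every bounded open convex set Ω ⊂ ℝⁿ with diam(Ω) = D, and every nonzero convex function u continuous on the closure of Ω, twice continuously differentiable in Ω, satisfying det D²u(z) = |u(z)|^{n−2} for all z ∈ Ω and u = 0 on ∂Ω, one has |u(z)| ≤ C · dist(z, ∂Ω) · (1 + |log dist(z, ∂Ω)|^{n/2}) for all z ∈ Ω. -/
open Metric MeasureTheory Real

/-- The Hessian matrix of `u : ℝⁿ → ℝ` at `x`, with entries the second partial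
derivatives `∂²u/∂xᵢ∂xⱼ` computed via iterated Fréchet derivatives. -/
noncomputable def hessianMatrix {n : ℕ} (u : EuclideanSpace ℝ (Fin n) → ℝ)
    (x : EuclideanSpace ℝ (Fin n)) : Matrix (Fin n) (Fin n) ℝ :=
  Matrix.of fun i j =>
    fderiv ℝ (fun y => fderiv ℝ u y (EuclideanSpace.single j 1)) x (EuclideanSpace.single i 1)

/-- The determinant of the Hessian matrix, `det D²u(x)`. -/
noncomputable def hessianDet {n : ℕ} (u : EuclideanSpace ℝ (Fin n) → ℝ)
    (x : EuclideanSpace ℝ (Fin n)) : ℝ := (hessianMatrix u x).det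

/-- A matrix bounded below by the identity has determinant at least one. -/
lemma one_le_det_one_add_of_posSemidef {ι : Type*} [Fintype ι] [DecidableEq ι]
    {P : Matrix ι ι ℝ} (hP : P.PosSemidef) : 1 ≤ (1 + P).det := by
  have hM : (1 + P).IsHermitian := Matrix.isHermitian_one.add hP.isHermitian
  rw [hM.det_eq_prod_eigenvalues]
  suffices h : ∀ i, 1 ≤ hM.eigenvalues i by
    simpa using Finset.prod_le_prod (s := Finset.univ) (fun _ _ => zero_le_one) fun i _ => h i
  intro i
  have hv : (hM.eigenvectorBasis i).ofLp ⬝ᵥ (hM.eigenvectorBasis i).ofLp = 1 := by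
    have := hM.eigenvectorBasis.orthonormal.1 i
    have h2 := real_inner_self_eq_norm_sq (hM.eigenvectorBasis i)
    rw [this, EuclideanSpace.inner_eq_star_dotProduct] at h2
    simpa using h2
  have h := hM.eigenvalues_eq i
  have h0 := hP.re_dotProduct_nonneg (hM.eigenvectorBasis i).ofLp
  simp only [Matrix.add_mulVec, Matrix.one_mulVec, dotProduct_add, star_trivial, hv,
    RCLike.re_to_real] at h h0
  linarith

open scoped MatrixOrder in
lemma Matrix.PosDef.det_le_det {ι : Type*} [Fintype ι] [DecidableEq ι]
    {Q H : Matrix ι ι ℝ} (hQ : Q.PosDef) (h : (H - Q).PosSemidef) : Q.det ≤ H.det := by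
  obtain ⟨B, rfl⟩ := CStarAlgebra.nonneg_iff_eq_star_mul_self.mp hQ.posSemidef.nonneg
  have hd := hQ.det_pos
  have hB : IsUnit B.det := by
    rw [Matrix.det_mul] at hd
    exact isUnit_iff_ne_zero.2 (right_ne_zero_of_mul hd.ne')
  have hP := h.conjTranspose_mul_mul_same B⁻¹
  have key : H = star B * (1 + (B⁻¹).conjTranspose * (H - star B * B) * B⁻¹) * B := by
    have e1 : star B * (B⁻¹).conjTranspose = 1 := by
      rw [Matrix.star_eq_conjTranspose, ← Matrix.conjTranspose_mul, Matrix.nonsing_inv_mul _ hB,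
        Matrix.conjTranspose_one]
    have e2 : B⁻¹ * B = 1 := Matrix.nonsing_inv_mul _ hB
    calc H = star B * B + (star B * (B⁻¹).conjTranspose) * (H - star B * B) * (B⁻¹ * B) := by
          rw [e1, e2]; simp
      _ = _ := by noncomm_ring
  rw [key, Matrix.det_mul, Matrix.det_mul, Matrix.det_mul]
  have := one_le_det_one_add_of_posSemidef hP
  rw [Matrix.det_mul] at hd
  nlinarith

open Matrix in
lemma det_ge_of_quadratic_form_ge {n : ℕ} (hn : 0 < n) {H : Matrix (Fin n) (Fin n) ℝ}
    (hH : H.IsHermitian) {α κ : ℝ} (hα : 0 < α) (hκ : 0 ≤ κ) {w : Fin n → ℝ} (hw : w ⬝ᵥ w = 1)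
    (h : ∀ ξ : Fin n → ℝ, α * (ξ ⬝ᵥ ξ) + κ * (w ⬝ᵥ ξ) ^ 2 ≤ ξ ⬝ᵥ (H *ᵥ ξ)) :
    α ^ (n - 1) * κ ≤ H.det := by
  set R : Matrix (Fin n) (Fin n) ℝ := vecMulVec w (star w) with hR
  have hRP : R.PosSemidef := posSemidef_vecMulVec_self_star w
  have hQ : (α • (1 : Matrix (Fin n) (Fin n) ℝ) + κ • R).PosDef :=
    (PosDef.one.smul hα).add_posSemidef (hRP.smul hκ)
  have hdet : (α • (1 : Matrix (Fin n) (Fin n) ℝ) + κ • R).det = α ^ n * (1 + κ / α) := by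
    have : α • (1 : Matrix (Fin n) (Fin n) ℝ) + κ • R =
        α • (1 + replicateCol Unit ((κ / α) • w) * replicateRow Unit w) := by
      ext i j
      simp [hR, vecMulVec_apply, Matrix.mul_apply]
      field_simp
    rw [this, det_smul, det_one_add_replicateCol_mul_replicateRow, dotProduct_smul, hw]
    simp
  have hle : (H - (α • (1 : Matrix (Fin n) (Fin n) ℝ) + κ • R)).PosSemidef := by
    refine PosSemidef.of_dotProduct_mulVec_nonneg (hH.sub hQ.isHermitian) fun ξ => ?_
    have := h ξ
    simp only [sub_mulVec, add_mulVec, smul_mulVec, one_mulVec, hR, vecMulVec_mulVec,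
      dotProduct_sub, dotProduct_add, dotProduct_smul, star_trivial, smul_eq_mul]
    rw [op_smul_eq_smul, smul_eq_mul, dotProduct_comm ξ w, ← sq]
    linarith
  refine le_trans ?_ (hQ.det_le_det hle)
  rw [hdet]
  obtain ⟨m, rfl⟩ : ∃ m, n = m + 1 := ⟨n - 1, by omega⟩
  have : α ^ (m + 1) * (1 + κ / α) = α ^ m * (α + κ) := by field_simp; ring
  rw [this, Nat.add_sub_cancel]
  gcongr
  linarith

lemma IsLocalMin.second_deriv_nonneg {h h' : ℝ → ℝ} {c : ℝ} {x : ℝ}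
    (hd : ∀ᶠ y in nhds x, HasDerivAt h (h' y) y) (hd2 : HasDerivAt h' c x)
    (hmin : IsLocalMin h x) : 0 ≤ c := by
  by_contra! hc
  have e : deriv h =ᶠ[nhds x] h' := hd.mono fun y hy => hy.deriv
  have e2 : deriv (deriv h) x = c := by rw [e.deriv_eq]; exact hd2.deriv
  have hmax := isLocalMax_of_deriv_deriv_neg (by rw [e2]; exact hc) hmin.deriv_eq_zero
    hd.self_of_nhds.continuousAt
  have hconst : h =ᶠ[nhds x] fun _ => h x := by
    filter_upwards [hmin, hmax] with y h1 h2 using le_antisymm h2 h1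
  have : deriv (deriv h) x = 0 := by
    have := hconst.deriv.deriv_eq
    simpa using this
  linarith

lemma hasDerivAt_mul_logPow {k β s : ℝ} (hs : 0 < s) (hl : 0 < k - log s) :
    HasDerivAt (fun s => s * (k - log s) ^ β)
      ((k - log s) ^ β - β * (k - log s) ^ (β - 1)) s := by
  have h1 : HasDerivAt (fun s => k - log s) (-s⁻¹) s := by
    simpa using (hasDerivAt_log hs.ne').const_sub k
  have h2 := (hasDerivAt_id s).mul (h1.rpow_const (p := β) (Or.inl hl.ne'))
  refine h2.congr_deriv ?_
  simp only [id]
  field_simp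
  ring

lemma hasDerivAt_deriv_mul_logPow {k β s : ℝ} (hs : 0 < s) (hl : 0 < k - log s) :
    HasDerivAt (fun s => (k - log s) ^ β - β * (k - log s) ^ (β - 1))
      (-(β * (k - log s) ^ (β - 2) * (k - log s - (β - 1)) / s)) s := by
  have h1 : HasDerivAt (fun s => k - log s) (-s⁻¹) s := by
    simpa using (hasDerivAt_log hs.ne').const_sub k
  have h2 := (h1.rpow_const (p := β) (Or.inl hl.ne')).sub
    ((h1.rpow_const (p := β - 1) (Or.inl hl.ne')).const_mul β)
  refine h2.congr_deriv ?_
  have e : (k - log s) ^ (β - 1) = (k - log s) ^ (β - 2) * (k - log s) := by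
    rw [← rpow_add_one hl.ne']; ring_nf
  rw [e, show β - 1 - 1 = β - 2 by ring]
  field_simp
  ring

lemma hasDerivAt_comp_line {n : ℕ} {u : EuclideanSpace ℝ (Fin n) → ℝ}
    {z : EuclideanSpace ℝ (Fin n)}
    (hu : ContDiffAt ℝ 2 u z) (ξ : EuclideanSpace ℝ (Fin n)) :
    (∀ᶠ t in nhds (0:ℝ), HasDerivAt (fun t : ℝ => u (z + t • ξ)) (fderiv ℝ u (z + t • ξ) ξ) t) ∧
    HasDerivAt (fun t : ℝ => fderiv ℝ u (z + t • ξ) ξ) (fderiv ℝ (fderiv ℝ u) z ξ ξ) 0 := by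
  have hline : ∀ t : ℝ, HasDerivAt (fun t : ℝ => z + t • ξ) ξ t := fun t => by
    simpa using ((hasDerivAt_id t).smul_const ξ).const_add z
  have hz : z + (0 : ℝ) • ξ = z := by simp
  constructor
  · have h1 : ∀ᶠ y in nhds z, ContDiffAt ℝ 2 u y := hu.eventually (by simp)
    have hc : Filter.Tendsto (fun t : ℝ => z + t • ξ) (nhds 0) (nhds z) := by
      have := (hline 0).continuousAt
      rwa [ContinuousAt, hz] at this
    filter_upwards [hc.eventually h1] with t ht
    exact (ht.differentiableAt (by simp)).hasFDerivAt.comp_hasDerivAt t (hline t)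
  · have h2 : DifferentiableAt ℝ (fderiv ℝ u) z :=
      (hu.fderiv_right (m := 1) (by norm_num)).differentiableAt (by simp)
    have h3 : HasFDerivAt (fderiv ℝ u) (fderiv ℝ (fderiv ℝ u) z) (z + (0:ℝ) • ξ) := by
      rw [hz]; exact h2.hasFDerivAt
    have h4 := h3.comp_hasDerivAt (0:ℝ) (hline 0)
    simpa using h4.clm_apply (hasDerivAt_const (0:ℝ) ξ)

lemma hessianMatrix_apply {n : ℕ} {u : EuclideanSpace ℝ (Fin n) → ℝ}
    {z : EuclideanSpace ℝ (Fin n)} (hu : ContDiffAt ℝ 2 u z) (i j : Fin n) :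
    hessianMatrix u z i j = fderiv ℝ (fderiv ℝ u) z (EuclideanSpace.single i 1)
      (EuclideanSpace.single j 1) := by
  have h2 : DifferentiableAt ℝ (fderiv ℝ u) z :=
    (hu.fderiv_right (m := 1) (by norm_num)).differentiableAt (by simp)
  simp [hessianMatrix, fderiv_clm_apply h2 (differentiableAt_const _)]

lemma isHermitian_hessianMatrix {n : ℕ} {u : EuclideanSpace ℝ (Fin n) → ℝ}
    {z : EuclideanSpace ℝ (Fin n)} (hu : ContDiffAt ℝ 2 u z) : (hessianMatrix u z).IsHermitian := by
  ext i j
  simp only [Matrix.conjTranspose_apply, hessianMatrix_apply hu, star_trivial]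
  exact (hu.isSymmSndFDerivAt (by simp)) _ _

open Matrix in
lemma dotProduct_hessianMatrix_mulVec {n : ℕ} {u : EuclideanSpace ℝ (Fin n) → ℝ}
    {z : EuclideanSpace ℝ (Fin n)} (hu : ContDiffAt ℝ 2 u z) (ξ : EuclideanSpace ℝ (Fin n)) :
    ξ.ofLp ⬝ᵥ (hessianMatrix u z *ᵥ ξ.ofLp) = fderiv ℝ (fderiv ℝ u) z ξ ξ := by
  have hξ : ξ = ∑ i, ξ i • EuclideanSpace.single i (1:ℝ) := by
    have := (EuclideanSpace.basisFun (Fin n) ℝ).sum_repr ξ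
    simpa using this.symm
  conv_rhs => rw [hξ]
  simp only [map_sum, map_smul, _root_.sum_apply, _root_.smul_apply,
    dotProduct, mulVec, hessianMatrix_apply hu, Finset.mul_sum, smul_eq_mul]
  rw [Finset.sum_comm]
  refine (Finset.sum_congr rfl fun i _ => Finset.sum_congr rfl fun j _ => ?_)
  ring

/-- The function `ψ(s) ‖x - p‖² / 2 - A φ(s)` with `ψ(s) = s (k - log s)^γ`,
`φ(s) = s (k - log s)^(γ + 1)` and `s = ⟪ν, x - p⟫ + d`. -/
noncomputable def logBarrier {n : ℕ} (k γ A d : ℝ) (p ν x : EuclideanSpace ℝ (Fin n)) : ℝ :=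
  (inner ℝ ν (x - p) + d) * (k - log (inner ℝ ν (x - p) + d)) ^ γ * (‖x - p‖ ^ 2 / 2) -
    A * ((inner ℝ ν (x - p) + d) * (k - log (inner ℝ ν (x - p) + d)) ^ (γ + 1))

/-- Second derivative at `0` of `ψ(s + τ σ) (Q + 2 τ m + τ² w) / 2 - A φ(s + τ σ)`. -/
lemma hasDerivAt_profile {k γ A s σ Q m w : ℝ} (hs : 0 < s) (hl : 0 < k - log s) :
    ∃ g : ℝ → ℝ,
      (∀ᶠ τ in nhds (0 : ℝ), HasDerivAt (fun τ : ℝ => (s + τ * σ) * (k - log (s + τ * σ)) ^ γ *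
          ((Q + 2 * τ * m + τ ^ 2 * w) / 2) -
          A * ((s + τ * σ) * (k - log (s + τ * σ)) ^ (γ + 1))) (g τ) τ) ∧
      HasDerivAt g
        (-(γ * (k - log s) ^ (γ - 2) * (k - log s - (γ - 1)) / s) * σ ^ 2 * (Q / 2) +
          2 * ((k - log s) ^ γ - γ * (k - log s) ^ (γ - 1)) * σ * m +
          s * (k - log s) ^ γ * w +
          A * ((γ + 1) * (k - log s) ^ (γ - 1) * (k - log s - γ) / s) * σ ^ 2) 0 := by
  have hline : ∀ τ : ℝ, HasDerivAt (fun τ : ℝ => s + τ * σ) σ τ := fun τ => by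
    simpa using ((hasDerivAt_id τ).mul_const σ).const_add s
  have hq : ∀ τ : ℝ, HasDerivAt (fun τ : ℝ => (Q + 2 * τ * m + τ ^ 2 * w) / 2) (m + τ * w) τ :=
    fun τ => by
      have h1 := ((hasDerivAt_id τ).const_mul 2).mul_const m
      have h2 := ((hasDerivAt_id τ).pow 2).mul_const w
      refine (((h1.const_add Q).add h2).div_const 2).congr_deriv ?_
      simp only [id, Nat.cast_ofNat]
      ring
  have hlin : HasDerivAt (fun τ : ℝ => m + τ * w) w 0 := by
    simpa using ((hasDerivAt_id (0 : ℝ)).mul_const w).const_add m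
  have hlog : ContinuousAt (fun τ : ℝ => k - log (s + τ * σ)) 0 := by
    refine continuousAt_const.sub (ContinuousAt.log (hline 0).continuousAt ?_)
    simpa using hs.ne'
  have hev : ∀ᶠ τ in nhds (0 : ℝ), 0 < s + τ * σ ∧ 0 < k - log (s + τ * σ) :=
    ((hline 0).continuousAt.eventually (lt_mem_nhds (by simpa using hs))).and
      (hlog.eventually (lt_mem_nhds (by simpa using hl)))
  refine ⟨fun τ => ((k - log (s + τ * σ)) ^ γ - γ * (k - log (s + τ * σ)) ^ (γ - 1)) * σ *
      ((Q + 2 * τ * m + τ ^ 2 * w) / 2) +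
      (s + τ * σ) * (k - log (s + τ * σ)) ^ γ * (m + τ * w) -
      A * (((k - log (s + τ * σ)) ^ (γ + 1) -
        (γ + 1) * (k - log (s + τ * σ)) ^ (γ + 1 - 1)) * σ), ?_, ?_⟩
  · filter_upwards [hev] with τ ⟨h1, h2⟩
    exact (((hasDerivAt_mul_logPow h1 h2).comp τ (hline τ)).mul (hq τ)).sub
      (((hasDerivAt_mul_logPow (β := γ + 1) h1 h2).comp τ (hline τ)).const_mul A)
  · have hs0 : 0 < s + 0 * σ := by simpa using hs
    have hl0 : 0 < k - log (s + 0 * σ) := by simpa using hl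
    have e1 := (((hasDerivAt_deriv_mul_logPow (β := γ) hs0 hl0).comp 0 (hline 0)).mul_const σ).mul
      (hq 0)
    have e2 := ((hasDerivAt_mul_logPow (β := γ) hs0 hl0).comp 0 (hline 0)).mul hlin
    have e3 := (((hasDerivAt_deriv_mul_logPow (β := γ + 1) hs0 hl0).comp 0 (hline 0)).mul_const
      σ).const_mul A
    refine ((e1.add e2).sub e3).congr_deriv ?_
    simp only [zero_mul, add_zero, Function.comp_apply, mul_zero, ne_eq, OfNat.ofNat_ne_zero,
      not_false_eq_true, zero_pow]
    rw [show γ + 1 - 2 = γ - 1 by ring, show γ + 1 - 1 = γ by ring]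
    ring

lemma profile_second_deriv_ge {k γ D s σ Q m x : ℝ} (hs : 0 < s) (hγ : 0 ≤ γ)
    (hl : 2 * γ + 2 ≤ k - log s) (hD : 0 < D) (hQ : Q ≤ D ^ 2)
    (hm : |m| ≤ D * x) :
    s * (k - log s) ^ γ / 2 * x ^ 2 + (k - log s) ^ γ / s * σ ^ 2 ≤
      (-(γ * (k - log s) ^ (γ - 2) * (k - log s - (γ - 1)) / s) * σ ^ 2 * (Q / 2) +
          2 * ((k - log s) ^ γ - γ * (k - log s) ^ (γ - 1)) * σ * m +
          s * (k - log s) ^ γ * x ^ 2 +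
          (4 * D ^ 2 + 2) * ((γ + 1) * (k - log s) ^ (γ - 1) * (k - log s - γ) / s) * σ ^ 2) := by
  set l := k - log s with hl'
  have hl0 : 0 < l := by linarith
  have e1 : l ^ (γ - 1) = l ^ γ / l := rpow_sub_one hl0.ne' γ
  have e2 : l ^ (γ - 2) = l ^ γ / l ^ 2 := by
    rw [rpow_sub hl0]; norm_num
  have hG : 0 < l ^ γ := rpow_pos_of_pos hl0 γ
  rw [e1, e2]
  set G := l ^ γ
  have a1 : γ * (G / l ^ 2) * (l - (γ - 1)) ≤ γ * G := by
    have : (G / l ^ 2) * (l - (γ - 1)) ≤ G := by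
      rw [div_mul_eq_mul_div, div_le_iff₀ (by positivity)]
      gcongr
      nlinarith
    nlinarith
  have a2 : (γ + 1) * G / 2 ≤ (γ + 1) * (G / l) * (l - γ) := by
    have : G / 2 ≤ (G / l) * (l - γ) := by
      rw [div_mul_eq_mul_div, le_div_iff₀ hl0]
      nlinarith
    nlinarith
  have a3 : |G - γ * (G / l)| ≤ G := by
    have h1 : γ * (G / l) ≤ G := by
      rw [← mul_div_assoc, div_le_iff₀ hl0]
      nlinarith
    have h2 : 0 ≤ γ * (G / l) := by positivity
    rw [abs_le]; constructor <;> linarith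
  have b1 : -(γ * G * D ^ 2 / (2 * s)) * σ ^ 2 ≤
      -(γ * (G / l ^ 2) * (l - (γ - 1)) / s) * σ ^ 2 * (Q / 2) := by
    have h0 : 0 ≤ γ * (G / l ^ 2) * (l - (γ - 1)) := by
      have : 0 ≤ l - (γ - 1) := by linarith
      positivity
    have h1 : γ * (G / l ^ 2) * (l - (γ - 1)) * Q ≤ γ * G * D ^ 2 :=
      (mul_le_mul_of_nonneg_left hQ h0).trans (mul_le_mul_of_nonneg_right a1 (sq_nonneg D))
    have h2 : 0 ≤ σ ^ 2 / (2 * s) := by positivity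
    have h3 := mul_le_mul_of_nonneg_right h1 h2
    calc _ = -(γ * G * D ^ 2 * (σ ^ 2 / (2 * s))) := by ring
      _ ≤ -(γ * (G / l ^ 2) * (l - (γ - 1)) * Q * (σ ^ 2 / (2 * s))) := neg_le_neg h3
      _ = _ := by ring
  have b2 : -(s * G / 2 * x ^ 2 + 2 * G * D ^ 2 / s * σ ^ 2) ≤ 2 * (G - γ * (G / l)) * σ * m := by
    have h1 : |2 * (G - γ * (G / l)) * σ * m| ≤ 2 * G * |σ| * (D * x) := by
      rw [abs_mul, abs_mul, abs_mul, abs_two]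
      gcongr
    have h2 : 2 * G * |σ| * (D * x) ≤ s * G / 2 * x ^ 2 + 2 * G * D ^ 2 / s * σ ^ 2 := by
      have : s * G / 2 * x ^ 2 + 2 * G * D ^ 2 / s * σ ^ 2 - 2 * G * |σ| * (D * x) =
          G / (2 * s) * (s * x - 2 * D * |σ|) ^ 2 := by
        rw [← sq_abs σ]
        field_simp
        ring
      have : 0 ≤ G / (2 * s) * (s * x - 2 * D * |σ|) ^ 2 := by positivity
      linarith
    have := neg_abs_le (2 * (G - γ * (G / l)) * σ * m)
    linarith
  have b3 : (4 * D ^ 2 + 2) * ((γ + 1) * G / 2 / s) * σ ^ 2 ≤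
      (4 * D ^ 2 + 2) * ((γ + 1) * (G / l) * (l - γ) / s) * σ ^ 2 := by gcongr
  have b4 : 0 ≤ G / s * σ ^ 2 * (γ * (D ^ 2 * 3 / 2 + 1)) := by positivity
  have b5 : (4 * D ^ 2 + 2) * ((γ + 1) * G / 2 / s) * σ ^ 2 - γ * G * D ^ 2 / (2 * s) * σ ^ 2
      - 2 * G * D ^ 2 / s * σ ^ 2 - G / s * σ ^ 2 = G / s * σ ^ 2 * (γ * (D ^ 2 * 3 / 2 + 1)) := by
    field_simp
    ring
  linarith

lemma second_fderiv_ge_of_isLocalMin_sub_logBarrier {n : ℕ} {u : EuclideanSpace ℝ (Fin n) → ℝ}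
    {k γ D d t : ℝ} {p ν z : EuclideanSpace ℝ (Fin n)} (hu : ContDiffAt ℝ 2 u z) (ht : 0 < t)
    (hmin : IsLocalMin (fun x => u x - t * logBarrier k γ (4 * D ^ 2 + 2) d p ν x) z)
    (hs : 0 < inner ℝ ν (z - p) + d) (hγ : 0 ≤ γ)
    (hl : 2 * γ + 2 ≤ k - log (inner ℝ ν (z - p) + d)) (hD : 0 < D) (hz : ‖z - p‖ ≤ D)
    (ξ : EuclideanSpace ℝ (Fin n)) :
    t * ((inner ℝ ν (z - p) + d) * (k - log (inner ℝ ν (z - p) + d)) ^ γ / 2 * ‖ξ‖ ^ 2 +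
      (k - log (inner ℝ ν (z - p) + d)) ^ γ / (inner ℝ ν (z - p) + d) * inner ℝ ν ξ ^ 2) ≤
      fderiv ℝ (fderiv ℝ u) z ξ ξ := by
  obtain ⟨g, hg1, hg2⟩ := hasDerivAt_profile (k := k) (γ := γ) (A := 4 * D ^ 2 + 2) (σ := inner ℝ ν ξ)
    (Q := ‖z - p‖ ^ 2) (m := inner ℝ (z - p) ξ) (w := ‖ξ‖ ^ 2) hs (by linarith)
  obtain ⟨hu1, hu2⟩ := hasDerivAt_comp_line hu ξ
  have hbar : ∀ τ : ℝ, logBarrier k γ (4 * D ^ 2 + 2) d p ν (z + τ • ξ) = _ := fun τ => by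
    have e1 : inner ℝ ν (z + τ • ξ - p) + d = inner ℝ ν (z - p) + d + τ * inner ℝ ν ξ := by
      rw [show z + τ • ξ - p = (z - p) + τ • ξ by abel, inner_add_right, inner_smul_right]
      ring
    have e2 : ‖z + τ • ξ - p‖ ^ 2 =
        ‖z - p‖ ^ 2 + 2 * τ * inner ℝ (z - p) ξ + τ ^ 2 * ‖ξ‖ ^ 2 := by
      rw [show z + τ • ξ - p = (z - p) + τ • ξ by abel, norm_add_sq_real, inner_smul_right,
        norm_smul, mul_pow, Real.norm_eq_abs, sq_abs]
      ring
    rw [logBarrier, e1, e2]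
  have hmin' : IsLocalMin (fun τ : ℝ => u (z + τ • ξ) -
      t * logBarrier k γ (4 * D ^ 2 + 2) d p ν (z + τ • ξ)) 0 := by
    have hc : ContinuousAt (fun τ : ℝ => z + τ • ξ) 0 := by fun_prop
    have hc' : Filter.Tendsto (fun τ : ℝ => z + τ • ξ) (nhds 0) (nhds z) := by
      simpa [ContinuousAt] using hc
    simpa [IsLocalMin, IsMinFilter] using hc'.eventually hmin
  simp only [hbar] at hmin'
  have h := hmin'.second_deriv_nonneg
    ((hu1.and hg1).mono fun τ hτ => hτ.1.sub (hτ.2.const_mul t)) (hu2.sub (hg2.const_mul t))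
  have key := profile_second_deriv_ge (σ := inner ℝ ν ξ) (Q := ‖z - p‖ ^ 2)
    (m := inner ℝ (z - p) ξ) (x := ‖ξ‖) hs hγ hl hD
    (by gcongr)
    ((abs_real_inner_le_norm _ _).trans (by gcongr))
  have := mul_le_mul_of_nonneg_left key ht.le
  linarith

lemma ConvexOn.nonpos_of_frontier {E : Type*} [NormedAddCommGroup E] [InnerProductSpace ℝ E]
    [ProperSpace E] [Nontrivial E] {Ω : Set E} {u : E → ℝ} (ho : IsOpen Ω)
    (hb : Bornology.IsBounded Ω) (hu : ContinuousOn u (closure Ω)) (hc : ConvexOn ℝ Ω u)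
    (h0 : ∀ z ∈ frontier Ω, u z = 0) {z : E} (hz : z ∈ Ω) : u z ≤ 0 := by
  by_contra! hpos
  obtain ⟨R, hR0, hR⟩ := hb.closure.exists_pos_norm_le
  set ε := u z / (2 * R ^ 2) with hε
  have hε0 : 0 < ε := by positivity
  have hcomp : IsCompact (closure Ω) := hb.isCompact_closure
  have hcont : ContinuousOn (fun x => u x + ε * ‖x‖ ^ 2) (closure Ω) :=
    hu.add (by fun_prop)
  obtain ⟨x, hx, hmax⟩ := hcomp.exists_isMaxOn ⟨z, subset_closure hz⟩ hcont
  have hxΩ : x ∈ Ω := by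
    by_contra hxn
    have h1 := h0 x ⟨hx, by rwa [ho.interior_eq]⟩
    have h2 : u z + ε * ‖z‖ ^ 2 ≤ u x + ε * ‖x‖ ^ 2 := hmax (subset_closure hz)
    have h3 : ε * ‖x‖ ^ 2 ≤ ε * R ^ 2 := by
      gcongr
      exact hR x hx
    have h4 : ε * R ^ 2 = u z / 2 := by
      rw [hε]; field_simp
    have h5 : 0 ≤ ε * ‖z‖ ^ 2 := by positivity
    linarith
  obtain ⟨r, hr, hball⟩ := Metric.isOpen_iff.1 ho x hxΩ
  obtain ⟨e, he0, he⟩ : ∃ e : E, e ≠ 0 ∧ ‖e‖ < r := by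
    obtain ⟨v, hv⟩ := exists_norm_eq E (c := r / 2) (by positivity)
    exact ⟨v, fun h => by rw [h, norm_zero] at hv; linarith, by linarith⟩
  have hp : x + e ∈ Ω := hball (by simpa using he)
  have hm : x - e ∈ Ω := hball (by simpa using he)
  have k1 : u (x + e) + ε * ‖x + e‖ ^ 2 ≤ u x + ε * ‖x‖ ^ 2 := hmax (subset_closure hp)
  have k2 : u (x - e) + ε * ‖x - e‖ ^ 2 ≤ u x + ε * ‖x‖ ^ 2 := hmax (subset_closure hm)
  have k3 := hc.2 hp hm (by norm_num : (0 : ℝ) ≤ 1 / 2)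
    (by norm_num : (0 : ℝ) ≤ 1 / 2) (by norm_num)
  rw [show (1 / 2 : ℝ) • (x + e) + (1 / 2 : ℝ) • (x - e) = x by module] at k3
  have k4 := parallelogram_law_with_norm ℝ x e
  have k5 : 0 < ε * ‖e‖ ^ 2 := by positivity
  simp only [smul_eq_mul] at k3
  nlinarith

lemma exists_unit_inner_nonneg_of_mem_frontier {E : Type*} [NormedAddCommGroup E]
    [InnerProductSpace ℝ E] [CompleteSpace E] {Ω : Set E} (ho : IsOpen Ω) (hc : Convex ℝ Ω)
    (hne : Ω.Nonempty) {p : E} (hp : p ∈ frontier Ω) :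
    ∃ ν : E, ‖ν‖ = 1 ∧ ∀ x ∈ closure Ω, 0 ≤ inner ℝ ν (x - p) := by
  have hpΩ : p ∉ Ω := fun h => hp.2 (by rwa [ho.interior_eq])
  obtain ⟨f, hf⟩ := geometric_hahn_banach_point_open hc ho hpΩ
  set w := (InnerProductSpace.toDual ℝ E).symm f
  have hfw : ∀ y, inner ℝ w y = f y := fun y => InnerProductSpace.toDual_symm_apply
  have hw0 : w ≠ 0 := by
    rintro h
    obtain ⟨x, hx⟩ := hne
    have := hf x hx
    rw [← hfw, ← hfw, h, inner_zero_left, inner_zero_left] at this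
    exact lt_irrefl _ this
  refine ⟨‖w‖⁻¹ • w, norm_smul_inv_norm hw0, fun x hx => ?_⟩
  have hclosed : IsClosed {x : E | 0 ≤ inner ℝ (‖w‖⁻¹ • w) (x - p)} :=
    isClosed_le continuous_const (by fun_prop)
  refine closure_minimal (fun y hy => ?_) hclosed hx
  have := hf y hy
  rw [Set.mem_ofPred_eq, real_inner_smul_left, inner_sub_right, hfw, hfw]
  exact mul_nonneg (inv_nonneg.2 (norm_nonneg _)) (by linarith)

lemma add_rpow_le_two_rpow_mul {a b p : ℝ} (ha : 0 ≤ a) (hb : 0 ≤ b) (hp : 0 ≤ p) :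
    (a + b) ^ p ≤ 2 ^ p * (a ^ p + b ^ p) := by
  have h1 : 0 ≤ a ^ p := rpow_nonneg ha p
  have h2 : 0 ≤ b ^ p := rpow_nonneg hb p
  have key : ∀ c, 0 ≤ c → a + b ≤ 2 * c → (a + b) ^ p ≤ 2 ^ p * c ^ p := fun c hc h => by
    rw [← mul_rpow zero_le_two hc]
    exact rpow_le_rpow (by positivity) h hp
  rcases le_total a b with h | h
  · exact (key b hb (by linarith)).trans (by gcongr; linarith)
  · exact (key a ha (by linarith)).trans (by gcongr; linarith)

lemma logBarrier_bounds {n : ℕ} {k γ D d : ℝ} {p ν x : EuclideanSpace ℝ (Fin n)}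
    (hs : 0 < inner ℝ ν (x - p) + d) (hγ : 0 ≤ γ)
    (hl : 2 * γ + 2 ≤ k - log (inner ℝ ν (x - p) + d)) (hx : ‖x - p‖ ≤ D) :
    logBarrier k γ (4 * D ^ 2 + 2) d p ν x < 0 ∧
    -logBarrier k γ (4 * D ^ 2 + 2) d p ν x ≤ (4 * D ^ 2 + 2) *
      ((inner ℝ ν (x - p) + d) * (k - log (inner ℝ ν (x - p) + d)) ^ (γ + 1)) := by
  rw [logBarrier]
  set s := inner ℝ ν (x - p) + d
  set l := k - log s
  have hl0 : 0 < l := by linarith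
  have hG : 0 < l ^ γ := rpow_pos_of_pos hl0 γ
  have hsG : 0 < s * l ^ γ := mul_pos hs hG
  have hq : ‖x - p‖ ^ 2 ≤ D ^ 2 := by gcongr
  constructor
  · rw [rpow_add_one hl0.ne']
    have h1 : ‖x - p‖ ^ 2 / 2 < (4 * D ^ 2 + 2) * l := by nlinarith [sq_nonneg D]
    have := mul_lt_mul_of_pos_left h1 hsG
    nlinarith
  · have : 0 ≤ s * l ^ γ * (‖x - p‖ ^ 2 / 2) := by positivity
    linarith

/-- A multiple `t` of the barrier can touch a solution from below only if `t` is controlled. -/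
lemma sq_le_of_isLocalMin_sub_logBarrier {n : ℕ} (hn : 2 ≤ n)
    {u : EuclideanSpace ℝ (Fin n) → ℝ} {k D d t : ℝ} {p ν z : EuclideanSpace ℝ (Fin n)}
    (hu : ContDiffAt ℝ 2 u z) (ht : 0 < t)
    (hmin : IsLocalMin
      (fun x => u x - t * logBarrier k (((n : ℝ) - 2) / 2) (4 * D ^ 2 + 2) d p ν x) z)
    (heq : u z = t * logBarrier k (((n : ℝ) - 2) / 2) (4 * D ^ 2 + 2) d p ν z)
    (hdet : hessianDet u z = |u z| ^ (n - 2))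
    (hs : 0 < inner ℝ ν (z - p) + d)
    (hl : n ≤ k - log (inner ℝ ν (z - p) + d)) (hD : 0 < D) (hz : ‖z - p‖ ≤ D)
    (hν : ‖ν‖ = 1) :
    t ^ 2 ≤ 2 ^ (n - 1) * (4 * D ^ 2 + 2) ^ (n - 2) := by
  have hn' : (2 : ℝ) ≤ n := by exact_mod_cast hn
  have hγ : 0 ≤ ((n : ℝ) - 2) / 2 := by linarith
  have hl' : 2 * (((n : ℝ) - 2) / 2) + 2 ≤ k - log (inner ℝ ν (z - p) + d) := by linarith
  obtain ⟨hneg, hle⟩ := logBarrier_bounds hs hγ hl' hz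
  have hquad := second_fderiv_ge_of_isLocalMin_sub_logBarrier hu ht hmin hs hγ hl' hD hz
  set V := logBarrier k (((n : ℝ) - 2) / 2) (4 * D ^ 2 + 2) d p ν z
  set s := inner ℝ ν (z - p) + d
  set l := k - log s
  have hl0 : 0 < l := by linarith
  have hG : 0 < l ^ (((n : ℝ) - 2) / 2) := rpow_pos_of_pos hl0 _
  have hG2 : (l ^ (((n : ℝ) - 2) / 2)) ^ 2 = l ^ (n - 2) := by
    rw [← rpow_natCast, ← rpow_mul hl0.le, ← rpow_natCast, Nat.cast_sub hn]
    congr 1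
    push_cast
    ring
  rw [rpow_add_one hl0.ne'] at hle
  set G := l ^ (((n : ℝ) - 2) / 2)
  have hdetge := det_ge_of_quadratic_form_ge (by omega : 0 < n) (isHermitian_hessianMatrix hu)
    (α := t * (s * G / 2)) (κ := t * (G / s)) (by positivity) (by positivity) (w := ν.ofLp)
    (by
      have h2 := real_inner_self_eq_norm_sq ν
      rw [hν, EuclideanSpace.inner_eq_star_dotProduct] at h2
      simpa using h2)
    (fun ξ => by
      have h := hquad (WithLp.toLp 2 ξ)
      rw [← dotProduct_hessianMatrix_mulVec hu] at h
      have h2 := real_inner_self_eq_norm_sq (WithLp.toLp 2 ξ)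
      rw [EuclideanSpace.inner_eq_star_dotProduct] at h2
      rw [← h2, EuclideanSpace.inner_eq_star_dotProduct] at h
      simp only [star_trivial] at h
      rw [dotProduct_comm ν.ofLp]
      linarith)
  have hdet' : (hessianMatrix u z).det = (t * -V) ^ (n - 2) := by
    rw [← hessianDet, hdet, heq, abs_of_neg (mul_neg_of_pos_of_neg ht hneg), mul_neg]
  rw [hdet'] at hdetge
  obtain ⟨m, rfl⟩ : ∃ m, n = m + 2 := ⟨n - 2, by omega⟩
  simp only [Nat.add_sub_cancel, show m + 2 - 1 = m + 1 by omega] at *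
  set A := 4 * D ^ 2 + 2
  have h1 : (t * -V) ^ m ≤ (t * (A * (s * (G * l)))) ^ m := by
    have : 0 ≤ -V := by linarith
    gcongr
  have h2 := hdetge.trans h1
  have h3 : (t * (s * G / 2)) ^ (m + 1) * (t * (G / s)) =
      t ^ 2 / 2 ^ (m + 1) * ((t * s * G) ^ m * G ^ 2) := by
    rw [show t * (s * G / 2) = (t * s * G) / 2 by ring, div_pow, pow_succ (t * s * G)]
    field_simp
  have h4 : (t * (A * (s * (G * l)))) ^ m = A ^ m * ((t * s * G) ^ m * G ^ 2) := by
    rw [hG2, ← mul_pow, ← mul_pow]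
    ring
  rw [h3, h4] at h2
  have h5 := le_of_mul_le_mul_right h2 (by positivity)
  rw [div_le_iff₀ (by positivity)] at h5
  linarith

/-- Log-Lipschitz type upper bound for solutions of
`det D²u = |u|^{n-2}` vanishing on the boundary. -/
theorem stmt_3 (n : ℕ) (hn : 2 ≤ n) (D : ℝ) (hD : 0 < D) :
    ∃ C : ℝ, 0 < C ∧
      ∀ (Ω : Set (EuclideanSpace ℝ (Fin n))) (u : EuclideanSpace ℝ (Fin n) → ℝ),
        IsOpen Ω → Bornology.IsBounded Ω → Convex ℝ Ω →
        Metric.diam Ω = D →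
        ContinuousOn u (closure Ω) → ContDiffOn ℝ 2 u Ω → ConvexOn ℝ Ω u →
        (∃ x ∈ Ω, u x ≠ 0) →
        (∀ z ∈ Ω, hessianDet u z = |u z| ^ (n - 2)) →
        (∀ z ∈ frontier Ω, u z = 0) →
        ∀ z ∈ Ω, |u z| ≤ C * infDist z (frontier Ω) *
          (1 + |Real.log (infDist z (frontier Ω))| ^ ((n : ℝ) / 2)) := by
  set T : ℝ := √(2 ^ (n - 1) * (4 * D ^ 2 + 2) ^ (n - 2)) with hT
  have hT0 : 0 < T := by positivity
  set k : ℝ := log (2 * D) + n with hk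
  refine ⟨T * (4 * D ^ 2 + 2) * 2 * (2 ^ ((n : ℝ) / 2) * (1 + |k| ^ ((n : ℝ) / 2))),
    by positivity, ?_⟩
  intro Ω u ho hb hconv hdiam hucont huC hucvx _ hdet h0 z hz
  have : Nonempty (Fin n) := ⟨⟨0, by omega⟩⟩
  have hn' : (2 : ℝ) ≤ n := by exact_mod_cast hn
  have hfr : (frontier Ω).Nonempty := by
    refine nonempty_frontier_iff.2 ⟨⟨z, hz⟩, ?_⟩
    rintro rfl
    exact NormedSpace.unbounded_univ ℝ (EuclideanSpace ℝ (Fin n)) hb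
  have hcomp : IsCompact (closure Ω) := hb.isCompact_closure
  obtain ⟨p, hp, hpd⟩ := isClosed_frontier.exists_infDist_eq_dist hfr z
  set d := infDist z (frontier Ω) with hd
  have hzp : z ≠ p := by
    rintro rfl
    exact hp.2 (by rwa [ho.interior_eq])
  have hd0 : 0 < d := by rw [hpd]; exact dist_pos.2 hzp
  obtain ⟨ν, hν, hνΩ⟩ := exists_unit_inner_nonneg_of_mem_frontier ho hconv ⟨z, hz⟩ hp
  have hdist : ∀ x ∈ closure Ω, ‖x - p‖ ≤ D := fun x hx => by
    rw [← dist_eq_norm, ← hdiam, ← Metric.diam_closure]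
    exact dist_le_diam_of_mem hb.closure hx hp.1
  have hinner : ∀ x, inner ℝ ν (x - p) ≤ ‖x - p‖ := fun x => by
    simpa [hν] using real_inner_le_norm ν (x - p)
  have hdD : d ≤ D := by
    rw [hpd, dist_eq_norm]
    exact hdist z (subset_closure hz)
  have hs : ∀ x ∈ closure Ω, 0 < inner ℝ ν (x - p) + d := fun x hx => by
    linarith [hνΩ x hx]
  have hl : ∀ x ∈ closure Ω, (n : ℝ) ≤ k - log (inner ℝ ν (x - p) + d) := fun x hx => by
    have := log_le_log (hs x hx)
      (by linarith [hinner x, hdist x hx] : inner ℝ ν (x - p) + d ≤ 2 * D)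
    linarith
  have hbd := fun x hx => logBarrier_bounds (k := k) (γ := ((n : ℝ) - 2) / 2) (hs x hx)
    (by linarith) (by linarith [hl x hx]) (hdist x hx)
  set V := logBarrier k (((n : ℝ) - 2) / 2) (4 * D ^ 2 + 2) d p ν with hV
  have hVcont : ContinuousOn V (closure Ω) := by
    have c1 : ContinuousOn (fun x => inner ℝ ν (x - p) + d) (closure Ω) := by fun_prop
    have c2 : ContinuousOn (fun x => k - log (inner ℝ ν (x - p) + d)) (closure Ω) :=
      continuousOn_const.sub (c1.log fun x hx => (hs x hx).ne')
    have c3 : ∀ β : ℝ, ContinuousOn (fun x => (k - log (inner ℝ ν (x - p) + d)) ^ β) (closure Ω) :=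
      fun β => c2.rpow_const fun x hx => Or.inl (by linarith [hl x hx])
    exact ((c1.mul (c3 _)).mul (by fun_prop)).sub (continuousOn_const.mul (c1.mul (c3 _)))
  obtain ⟨x, hx, hmax⟩ := hcomp.exists_isMaxOn ⟨z, subset_closure hz⟩
    (hucont.div hVcont fun x hx => (hbd x hx).1.ne)
  set t := u x / V x with ht
  have htouch : ∀ y ∈ closure Ω, t * V y ≤ u y := fun y hy => by
    have h1 : u y / V y ≤ t := hmax hy
    exact (div_le_iff_of_neg (hbd y hy).1).1 h1
  have htT : t ≤ T := by
    rcases le_or_gt t 0 with h | h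
    · linarith
    have hxΩ : x ∈ Ω := by
      by_contra hxn
      have := h0 x ⟨hx, by rwa [ho.interior_eq]⟩
      rw [ht, this, zero_div] at h
      exact lt_irrefl _ h
    have heq : u x = t * V x := (div_mul_cancel₀ _ (hbd x hx).1.ne).symm
    refine le_sqrt_of_sq_le (sq_le_of_isLocalMin_sub_logBarrier hn
      (huC.contDiffAt (ho.mem_nhds hxΩ)) h ?_ heq (hdet x hxΩ) (hs x hx) (hl x hx) hD (hdist x hx)
      hν)
    filter_upwards [ho.mem_nhds hxΩ] with y hy
    have := htouch y (subset_closure hy)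
    rw [← hV]
    linarith
  have hzc : z ∈ closure Ω := subset_closure hz
  rw [abs_of_nonpos (hucvx.nonpos_of_frontier ho hb hucont h0 hz)]
  obtain ⟨hVneg, hVle⟩ := hbd z hzc
  set s := inner ℝ ν (z - p) + d with hsdef
  have hs1 : d ≤ s := by linarith [hνΩ z hzc]
  have hs2 : s ≤ 2 * d := by
    have := hinner z
    rw [← dist_eq_norm, ← hpd] at this
    linarith
  have hlz : (n : ℝ) ≤ k - log s := hl z hzc
  have hpow : (k - log s) ^ (((n : ℝ) - 2) / 2 + 1) ≤
      2 ^ ((n : ℝ) / 2) * (|k| ^ ((n : ℝ) / 2) + |log d| ^ ((n : ℝ) / 2)) := by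
    rw [show ((n : ℝ) - 2) / 2 + 1 = (n : ℝ) / 2 by ring]
    refine le_trans (rpow_le_rpow (by linarith) ?_ (by linarith))
      (add_rpow_le_two_rpow_mul (abs_nonneg _) (abs_nonneg _) (by linarith))
    have := log_le_log hd0 hs1
    linarith [le_abs_self k, neg_abs_le (log d)]
  have hk0 : 0 ≤ |k| ^ ((n : ℝ) / 2) := by positivity
  have hL0 : 0 ≤ |log d| ^ ((n : ℝ) / 2) := by positivity
  calc -u z ≤ t * -V z := by linarith [htouch z hzc]
    _ ≤ T * -V z := mul_le_mul_of_nonneg_right htT (by linarith)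
    _ ≤ T * ((4 * D ^ 2 + 2) * (s * (k - log s) ^ (((n : ℝ) - 2) / 2 + 1))) := by gcongr
    _ ≤ T * ((4 * D ^ 2 + 2) * ((2 * d) *
        (2 ^ ((n : ℝ) / 2) * (|k| ^ ((n : ℝ) / 2) + |log d| ^ ((n : ℝ) / 2))))) := by
      have : 0 ≤ (k - log s) ^ (((n : ℝ) - 2) / 2 + 1) := rpow_nonneg (by linarith) _
      gcongr
    _ ≤ T * ((4 * D ^ 2 + 2) * ((2 * d) *
        (2 ^ ((n : ℝ) / 2) * ((1 + |k| ^ ((n : ℝ) / 2)) * (1 + |log d| ^ ((n : ℝ) / 2)))))) := by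
      gcongr
      nlinarith
    _ = _ := by ring
end

section
/- Let n ≥ 2 and let Ω ⊂ ℝⁿ₊ be a bounded open convex set with 0 ∈ ∂Ω, and set D = diam(Ω). For a > 1, define A = (1 + (a+1)D²)/(a − 1), B = D^{a−1}(A + D²), and v(x) = xₙ^a (|x′|² + A) − B·xₙ for x = (x′, xₙ) in the closure of Ω. Then v is Lipschitz on the closure of Ω and smooth in Ω, v is convex in Ω, v ≤ 0 on the closure of Ω, and for all x ∈ Ω one has det D²v(x) ≥ 2^{n−1} a · xₙ^{na−2} ≥ (2^{n−1} a / B^{na−2}) · |v(x)|^{na−2}. -/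
open Metric MeasureTheory Real

/-- The function `xₖ ^ a (∑_{i ≠ k} xᵢ² + A) - B xₖ`. -/
noncomputable def powerBarrier {n : ℕ} (k : Fin n) (a A B : ℝ) (x : EuclideanSpace ℝ (Fin n)) : ℝ :=
  x k ^ a * ((∑ i ∈ Finset.univ.erase k, x i ^ 2) + A) - B * x k

lemma contDiffAt_powerBarrier {n : ℕ} {k : Fin n} {a : ℝ} (A B : ℝ) {N : WithTop ℕ∞}
    {x : EuclideanSpace ℝ (Fin n)} (h : ContDiffAt ℝ N (fun t : ℝ => t ^ a) (x k)) :
    ContDiffAt ℝ N (powerBarrier k a A B) x := by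
  have hc : ∀ i, ContDiffAt ℝ N (fun y : EuclideanSpace ℝ (Fin n) => y i) x := fun i =>
    (EuclideanSpace.proj (𝕜 := ℝ) i).contDiff.contDiffAt
  have hp : ContDiffAt ℝ N (fun y : EuclideanSpace ℝ (Fin n) => y k ^ a) x :=
    ContDiffAt.comp x (g := fun t : ℝ => t ^ a) h (hc k)
  exact (hp.mul ((ContDiffAt.sum fun i _ => (hc i).pow 2).add contDiffAt_const)).sub
    (contDiffAt_const.mul (hc k))

lemma hasFDerivAt_coord {n : ℕ} (x : EuclideanSpace ℝ (Fin n)) (i : Fin n) :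
    HasFDerivAt (fun y : EuclideanSpace ℝ (Fin n) => y i) (EuclideanSpace.proj (𝕜 := ℝ) i) x :=
  (EuclideanSpace.proj (𝕜 := ℝ) i).hasFDerivAt

/-- A power of one coordinate times a quadratic function of the others: the common factor of
the barrier and of its `k`-th partial derivative. -/
lemma hasFDerivAt_rpow_mul_sum_sq {n : ℕ} {k : Fin n} {p : ℝ} (A : ℝ)
    {x : EuclideanSpace ℝ (Fin n)} (h : x k ≠ 0 ∨ 1 ≤ p) :
    HasFDerivAt
      (fun y : EuclideanSpace ℝ (Fin n) => y k ^ p * ((∑ i ∈ Finset.univ.erase k, y i ^ 2) + A))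
      (x k ^ p • (∑ i ∈ Finset.univ.erase k, (2 * x i) • EuclideanSpace.proj (𝕜 := ℝ) i) +
        ((∑ i ∈ Finset.univ.erase k, x i ^ 2) + A) •
          ((p * x k ^ (p - 1)) • EuclideanSpace.proj (𝕜 := ℝ) k)) x := by
  have hs : HasFDerivAt
      (fun y : EuclideanSpace ℝ (Fin n) => (∑ i ∈ Finset.univ.erase k, y i ^ 2) + A)
      (∑ i ∈ Finset.univ.erase k, (2 * x i) • EuclideanSpace.proj (𝕜 := ℝ) i) x := by
    refine (HasFDerivAt.fun_sum fun i _ => ?_).add_const A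
    simpa using (hasFDerivAt_coord x i).pow 2
  exact ((hasFDerivAt_coord x k).rpow_const h).mul hs

lemma sum_smul_proj_single {n : ℕ} (k j : Fin n) (x : EuclideanSpace ℝ (Fin n)) :
    (∑ i ∈ Finset.univ.erase k, (2 * x i) • EuclideanSpace.proj (𝕜 := ℝ) i :
      EuclideanSpace ℝ (Fin n) →L[ℝ] ℝ) (EuclideanSpace.single j 1) =
      if j = k then 0 else 2 * x j := by
  rcases eq_or_ne j k with rfl | h
  · simp
  · simp [h, h.symm]

lemma fderiv_powerBarrier_single {n : ℕ} (k j : Fin n) {a : ℝ} (ha : 1 ≤ a) (A B : ℝ)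
    (x : EuclideanSpace ℝ (Fin n)) :
    fderiv ℝ (powerBarrier k a A B) x (EuclideanSpace.single j 1) =
      if j = k then a * (x k ^ (a - 1) * ((∑ i ∈ Finset.univ.erase k, x i ^ 2) + A)) - B
      else 2 * (x k ^ a * x j) := by
  have h : HasFDerivAt (powerBarrier k a A B) _ x :=
    (hasFDerivAt_rpow_mul_sum_sq A (Or.inr ha)).sub ((hasFDerivAt_coord x k).const_mul B)
  rw [h.fderiv]
  simp only [sub_apply, add_apply,
    smul_apply, sum_smul_proj_single, smul_eq_mul]
  split_ifs with hj
  · subst hj; simp; ring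
  · simp [Ne.symm hj]; ring

lemma hessianMatrix_powerBarrier {n : ℕ} (k : Fin n) {a : ℝ} (ha : 1 ≤ a) (A B : ℝ)
    {x : EuclideanSpace ℝ (Fin n)} (hx : x k ≠ 0) (i j : Fin n) :
    hessianMatrix (powerBarrier k a A B) x i j =
      if j = k then
        if i = k then
          a * (a - 1) * x k ^ (a - 2) * ((∑ i ∈ Finset.univ.erase k, x i ^ 2) + A)
        else 2 * a * x k ^ (a - 1) * x i
      else if i = k then 2 * a * x k ^ (a - 1) * x j
      else if i = j then 2 * x k ^ a else 0 := by
  simp only [hessianMatrix, Matrix.of_apply, fderiv_powerBarrier_single k j ha A B]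
  by_cases hj : j = k
  · simp only [hj, if_true]
    have h := ((hasFDerivAt_rpow_mul_sum_sq (k := k) (p := a - 1) A (Or.inl hx)).const_mul
      a).sub_const B
    rw [h.fderiv]
    simp only [add_apply,
      smul_apply, sum_smul_proj_single, smul_eq_mul]
    split_ifs with hi
    · subst hi; simp [show a - 1 - 1 = a - 2 by ring]; ring
    · simp [Ne.symm hi]; ring
  · simp only [hj, if_false]
    have h : HasFDerivAt (fun y : EuclideanSpace ℝ (Fin n) => 2 * (y k ^ a * y j)) _ x :=
      (((hasFDerivAt_coord x k).rpow_const (p := a) (Or.inl hx)).mul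
        (hasFDerivAt_coord x j)).const_mul 2
    rw [h.fderiv]
    by_cases hi : i = k
    · subst hi; simp [hj]; ring
    · by_cases hij : i = j
      · subst hij; simp [Ne.symm hi, hi]
      · simp [Ne.symm hi, hi, hij, Ne.symm hij]

/-- Determinant of an arrowhead matrix with constant diagonal block. -/
lemma det_arrowhead {R : Type*} [Field R] {m : ℕ} (M : Matrix (Fin (m + 1)) (Fin (m + 1)) R) {c : R}
    (hc : c ≠ 0) (b : Fin m → R)
    (hM : ∀ i j : Fin m, M i.castSucc j.castSucc = if i = j then c else 0)
    (hr : ∀ j : Fin m, M (Fin.last m) j.castSucc = b j)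
    (hl : ∀ i : Fin m, M i.castSucc (Fin.last m) = b i) :
    M.det = c ^ m * (M (Fin.last m) (Fin.last m) - (∑ i, b i ^ 2) / c) := by
  have hblock : M.submatrix finSumFinEquiv finSumFinEquiv =
      Matrix.fromBlocks (c • (1 : Matrix (Fin m) (Fin m) R)) (Matrix.of fun i (_ : Fin 1) => b i)
        (Matrix.of fun (_ : Fin 1) j => b j)
        (Matrix.of fun (_ _ : Fin 1) => M (Fin.last m) (Fin.last m)) := by
    have hlast : ∀ i : Fin 1, Fin.natAdd m i = Fin.last m := fun i => by
      ext; simp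
    have hcast : ∀ i : Fin m, Fin.castAdd 1 i = i.castSucc := fun _ => rfl
    ext (i | i) (j | j) <;>
      simp [finSumFinEquiv_apply_left, finSumFinEquiv_apply_right, hlast, hcast, hM, hr, hl, Matrix.one_apply]
  let _ : Invertible (c • (1 : Matrix (Fin m) (Fin m) R)) :=
    ⟨c⁻¹ • 1, by simp [smul_smul, hc], by simp [smul_smul, hc]⟩
  rw [← Matrix.det_submatrix_equiv_self finSumFinEquiv M, hblock, Matrix.det_fromBlocks₁₁]
  have hinv : ⅟ (c • (1 : Matrix (Fin m) (Fin m) R)) = c⁻¹ • 1 := rfl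
  rw [hinv]
  simp only [Matrix.det_smul, Fintype.card_fin, Matrix.det_one, mul_one, Matrix.det_unique,
    Matrix.sub_apply, Matrix.of_apply, Matrix.mul_smul, Matrix.smul_mul, Matrix.smul_apply,
    Matrix.mul_one, smul_eq_mul]
  rw [Matrix.mul_apply]
  congr 2
  rw [div_eq_inv_mul]
  congr 1
  exact Finset.sum_congr rfl fun i _ => (sq _).symm

lemma sum_erase_last {m : ℕ} (f : Fin (m + 1) → ℝ) :
    ∑ i ∈ Finset.univ.erase (Fin.last m), f i = ∑ i : Fin m, f i.castSucc := by
  rw [Finset.sum_erase_eq_sub (Finset.mem_univ _), Fin.sum_univ_castSucc, add_sub_cancel_right]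

lemma hessianDet_powerBarrier {m : ℕ} {a : ℝ} (ha : 1 ≤ a) (A B : ℝ)
    {x : EuclideanSpace ℝ (Fin (m + 1))} (hx : 0 < x (Fin.last m)) :
    hessianDet (powerBarrier (Fin.last m) a A B) x =
      2 ^ m * a * x (Fin.last m) ^ (((m + 1 : ℕ) : ℝ) * a - 2) *
        ((a - 1) * A - (a + 1) * ∑ i ∈ Finset.univ.erase (Fin.last m), x i ^ 2) := by
  set t := x (Fin.last m) with ht
  have hM := hessianMatrix_powerBarrier (Fin.last m) ha A B hx.ne'
  have hlast : ∀ i : Fin m, i.castSucc ≠ Fin.last m := fun i => (Fin.castSucc_lt_last i).ne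
  rw [hessianDet, det_arrowhead (c := 2 * t ^ a) _ (by positivity)
    (fun i => 2 * a * t ^ (a - 1) * x i.castSucc)
    (fun i j => by simp [hM, hlast, ht]) (fun j => by simp [hM, hlast, ht])
    (fun i => by simp [hM, hlast, ht]), hM, sum_erase_last]
  simp only [if_true, ← ht]
  set S := ∑ i : Fin m, x i.castSucc ^ 2
  have h1 : t ^ (a - 1) = t ^ (a - 2) * t := by
    rw [← Real.rpow_add_one hx.ne']; ring_nf
  have h2 : t ^ a = t ^ (a - 2) * t ^ 2 := by
    rw [← Real.rpow_natCast t 2, ← Real.rpow_add hx]; ring_nf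
  have h3 : t ^ (((m + 1 : ℕ) : ℝ) * a - 2) = (t ^ a) ^ m * t ^ (a - 2) := by
    rw [← Real.rpow_natCast (t ^ a) m, ← Real.rpow_mul hx.le, ← Real.rpow_add hx]
    push_cast; ring_nf
  have hS : (∑ i : Fin m, (2 * a * t ^ (a - 1) * x i.castSucc) ^ 2) / (2 * t ^ a) =
      2 * a ^ 2 * t ^ (a - 2) * S := by
    simp only [mul_pow, ← Finset.mul_sum]
    rw [h1, h2]
    have : t ^ (a - 2) ≠ 0 := by positivity
    field_simp
    simp only [S]
  rw [hS, h3, mul_pow]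
  ring

lemma quadratic_form_nonneg {ι : Type*} (s : Finset ι) (y ξ : ι → ℝ) {a A T τ : ℝ} (ha : 0 ≤ a)
    (hA : (a + 1) * ∑ i ∈ s, y i ^ 2 ≤ (a - 1) * A) :
    0 ≤ a * (a - 1) * τ ^ 2 * ((∑ i ∈ s, y i ^ 2) + A) + 2 * a * τ * T * (∑ i ∈ s, 2 * y i * ξ i) +
      T ^ 2 * ∑ i ∈ s, 2 * ξ i ^ 2 := by
  have hsq : 0 ≤ ∑ i ∈ s, 2 * (a * τ * y i + T * ξ i) ^ 2 :=
    Finset.sum_nonneg fun i _ => by positivity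
  have hexp : ∑ i ∈ s, 2 * (a * τ * y i + T * ξ i) ^ 2 =
      2 * a ^ 2 * τ ^ 2 * (∑ i ∈ s, y i ^ 2) + 2 * a * τ * T * (∑ i ∈ s, 2 * y i * ξ i) +
        T ^ 2 * ∑ i ∈ s, 2 * ξ i ^ 2 := by
    simp only [Finset.mul_sum, ← Finset.sum_add_distrib]
    exact Finset.sum_congr rfl fun i _ => by ring
  nlinarith [mul_le_mul_of_nonneg_left hA (mul_nonneg ha (sq_nonneg τ))]

lemma convexOn_segment_rpow_mul {ι : Type*} (s : Finset ι) (x ξ : ι → ℝ) {a A B t τ : ℝ}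
    (ha : 1 < a) (hpos : ∀ r ∈ Set.Icc (0 : ℝ) 1, 0 < t + r * τ)
    (hA : ∀ r ∈ Set.Icc (0 : ℝ) 1, (a + 1) * ∑ i ∈ s, (x i + r * ξ i) ^ 2 ≤ (a - 1) * A) :
    ConvexOn ℝ (Set.Icc 0 1)
      (fun r => (t + r * τ) ^ a * ((∑ i ∈ s, (x i + r * ξ i) ^ 2) + A) - B * (t + r * τ)) := by
  have hlin : ∀ c d r : ℝ, HasDerivAt (fun r : ℝ => c + r * d) d r := fun c d r => by
    simpa using ((hasDerivAt_id r).mul_const d).const_add c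
  have hsum : ∀ r, HasDerivAt (fun r => (∑ i ∈ s, (x i + r * ξ i) ^ 2) + A)
      (∑ i ∈ s, 2 * (x i + r * ξ i) * ξ i) r := fun r => by
    refine (HasDerivAt.fun_sum fun i _ => ?_).add_const A
    simpa using (hlin (x i) (ξ i) r).fun_pow 2
  have hsum2 : ∀ r, HasDerivAt (fun r => ∑ i ∈ s, 2 * (x i + r * ξ i) * ξ i)
      (∑ i ∈ s, 2 * ξ i ^ 2) r := fun r => by
    refine HasDerivAt.fun_sum fun i _ => ?_
    exact (((hlin (x i) (ξ i) r).const_mul 2).mul_const (ξ i)).congr_deriv (by ring)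
  have hpow : ∀ p : ℝ, ∀ r ∈ Set.Icc (0 : ℝ) 1,
      HasDerivAt (fun r => (t + r * τ) ^ p) (τ * p * (t + r * τ) ^ (p - 1)) r := fun p r hr =>
    (hlin t τ r).rpow_const (Or.inl (hpos r hr).ne')
  have hderiv : ∀ r ∈ Set.Icc (0 : ℝ) 1, HasDerivAt
      (fun r => (t + r * τ) ^ a * ((∑ i ∈ s, (x i + r * ξ i) ^ 2) + A) - B * (t + r * τ))
      (τ * a * (t + r * τ) ^ (a - 1) * ((∑ i ∈ s, (x i + r * ξ i) ^ 2) + A) +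
        (t + r * τ) ^ a * (∑ i ∈ s, 2 * (x i + r * ξ i) * ξ i) - B * τ) r := fun r hr =>
    ((hpow a r hr).mul (hsum r)).sub ((hlin t τ r).const_mul B)
  have hderiv2 : ∀ r ∈ Set.Icc (0 : ℝ) 1, HasDerivAt
      (fun r => τ * a * (t + r * τ) ^ (a - 1) * ((∑ i ∈ s, (x i + r * ξ i) ^ 2) + A) +
        (t + r * τ) ^ a * (∑ i ∈ s, 2 * (x i + r * ξ i) * ξ i) - B * τ)
      (τ * a * (τ * (a - 1) * (t + r * τ) ^ (a - 1 - 1)) *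
          ((∑ i ∈ s, (x i + r * ξ i) ^ 2) + A) +
        τ * a * (t + r * τ) ^ (a - 1) * (∑ i ∈ s, 2 * (x i + r * ξ i) * ξ i) +
        (τ * a * (t + r * τ) ^ (a - 1) * (∑ i ∈ s, 2 * (x i + r * ξ i) * ξ i) +
          (t + r * τ) ^ a * ∑ i ∈ s, 2 * ξ i ^ 2)) r := fun r hr =>
    (((((hpow (a - 1) r hr).const_mul (τ * a)).mul (hsum r)).add
      ((hpow a r hr).mul (hsum2 r))).sub_const _)
  refine convexOn_of_hasDerivWithinAt2_nonneg (convex_Icc 0 1)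
    (fun r hr => (hderiv r hr).continuousAt.continuousWithinAt)
    (fun r hr => (hderiv r (interior_subset hr)).hasDerivWithinAt)
    (fun r hr => (hderiv2 r (interior_subset hr)).hasDerivWithinAt) fun r hr => ?_
  have hr' := interior_subset hr
  have hT := hpos r hr'
  set T := t + r * τ
  have h1 : T ^ (a - 1) = T ^ (a - 2) * T := by
    rw [← Real.rpow_add_one hT.ne']; ring_nf
  have h2 : T ^ a = T ^ (a - 2) * T ^ 2 := by
    rw [← Real.rpow_natCast T 2, ← Real.rpow_add hT]; ring_nf
  have hq := mul_nonneg (Real.rpow_nonneg hT.le (a - 2))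
    (quadratic_form_nonneg s (fun i => x i + r * ξ i) ξ (T := T) (τ := τ) (by linarith) (hA r hr'))
  rw [show a - 1 - 1 = a - 2 by ring, h1, h2]
  refine hq.trans_eq ?_
  ring

lemma convexOn_powerBarrier {n : ℕ} (k : Fin n) {a A : ℝ} (ha : 1 < a) (B : ℝ)
    {Ω : Set (EuclideanSpace ℝ (Fin n))} (hΩ : Convex ℝ Ω) (hpos : ∀ x ∈ Ω, 0 < x k)
    (hA : ∀ x ∈ Ω, (a + 1) * ∑ i ∈ Finset.univ.erase k, x i ^ 2 ≤ (a - 1) * A) :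
    ConvexOn ℝ Ω (powerBarrier k a A B) := by
  refine ⟨hΩ, fun x hx y hy p q hp hq hpq => ?_⟩
  have hmem : ∀ r ∈ Set.Icc (0 : ℝ) 1, x + r • (y - x) ∈ Ω := fun r hr =>
    hΩ.add_smul_sub_mem hx hy hr
  have hconv := convexOn_segment_rpow_mul (Finset.univ.erase k) (fun i => x i)
    (fun i => y i - x i) (B := B) (t := x k) (τ := y k - x k) ha
    (fun r hr => by simpa using hpos _ (hmem r hr)) (fun r hr => by simpa using hA _ (hmem r hr))
  have h := hconv.2 (Set.left_mem_Icc.2 zero_le_one) (Set.right_mem_Icc.2 zero_le_one) hp hq hpq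
  have hp' : p = 1 - q := by linarith
  subst hp'
  have e : ∀ i, (((1 - q) • x + q • y : EuclideanSpace ℝ (Fin n)) i) = x i + q * (y i - x i) :=
    fun i => by simp; ring
  simpa [powerBarrier, e] using h

lemma sum_erase_sq_le {n : ℕ} (k : Fin n) {D : ℝ} {x : EuclideanSpace ℝ (Fin n)} (hx : ‖x‖ ≤ D) :
    ∑ i ∈ Finset.univ.erase k, x i ^ 2 ≤ D ^ 2 := by
  calc ∑ i ∈ Finset.univ.erase k, x i ^ 2 ≤ ∑ i, x i ^ 2 :=
        Finset.sum_le_univ_sum_of_nonneg fun i => sq_nonneg _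
    _ = ‖x‖ ^ 2 := (EuclideanSpace.real_norm_sq_eq x).symm
    _ ≤ D ^ 2 := by gcongr

/-- On the part of the ball of radius `D` where `xₖ ≥ 0`, the power term of the barrier is
dominated by its linear term. -/
lemma rpow_mul_le_of_norm_le {n : ℕ} (k : Fin n) {a A D : ℝ} (ha : 1 < a) (hA : 0 ≤ A)
    {x : EuclideanSpace ℝ (Fin n)} (hk : 0 ≤ x k) (hx : ‖x‖ ≤ D) :
    x k ^ a * ((∑ i ∈ Finset.univ.erase k, x i ^ 2) + A) ≤
      D ^ (a - 1) * (A + D ^ 2) * x k := by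
  have hs := sum_erase_sq_le k hx
  have hkD : x k ≤ D := (le_abs_self _).trans ((PiLp.norm_apply_le x k).trans hx)
  have h1 : x k ^ a = x k ^ (a - 1) * x k := by
    rcases hk.eq_or_lt with h | h
    · rw [← h, Real.zero_rpow (by linarith), mul_zero]
    · rw [← Real.rpow_add_one h.ne', sub_add_cancel]
  have h2 : x k ^ (a - 1) ≤ D ^ (a - 1) := Real.rpow_le_rpow hk hkD (by linarith)
  have hD : 0 ≤ D := hk.trans hkD
  calc x k ^ a * ((∑ i ∈ Finset.univ.erase k, x i ^ 2) + A)
      ≤ (D ^ (a - 1) * x k) * (A + D ^ 2) := by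
        rw [h1]
        exact mul_le_mul (by gcongr) (by linarith) (by positivity) (by positivity)
    _ = _ := by ring


/-- The globally Lipschitz convex subsolution
`v(x) = xₙ^a (|x'|² + A) - B xₙ` and its properties. -/
theorem stmt_8 (n : ℕ) (hn : 2 ≤ n)
    (Ω : Set (EuclideanSpace ℝ (Fin n)))
    (hΩo : IsOpen Ω) (hΩb : Bornology.IsBounded Ω) (hΩc : Convex ℝ Ω)
    (hΩpos : ∀ x ∈ Ω, 0 < x ⟨n - 1, by omega⟩)
    (h0 : (0 : EuclideanSpace ℝ (Fin n)) ∈ frontier Ω)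
    (D : ℝ) (hD : D = Metric.diam Ω)
    (a : ℝ) (ha : 1 < a)
    (A B : ℝ)
    (hA : A = (1 + (a + 1) * D ^ 2) / (a - 1))
    (hB : B = D ^ (a - 1) * (A + D ^ 2))
    (v : EuclideanSpace ℝ (Fin n) → ℝ)
    (hv : v = fun x => x ⟨n - 1, by omega⟩ ^ a *
        ((∑ i ∈ Finset.univ.erase (⟨n - 1, by omega⟩ : Fin n), x i ^ 2) + A) -
        B * x ⟨n - 1, by omega⟩) :
    (∃ K : NNReal, LipschitzOnWith K v (closure Ω)) ∧
    ContDiffOn ℝ (⊤ : ℕ∞) v Ω ∧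
    ConvexOn ℝ Ω v ∧
    (∀ x ∈ closure Ω, v x ≤ 0) ∧
    (∀ x ∈ Ω,
      hessianDet v x ≥ (2 : ℝ) ^ (n - 1) * a * x ⟨n - 1, by omega⟩ ^ ((n : ℝ) * a - 2) ∧
      (2 : ℝ) ^ (n - 1) * a * x ⟨n - 1, by omega⟩ ^ ((n : ℝ) * a - 2) ≥
        (2 : ℝ) ^ (n - 1) * a / B ^ ((n : ℝ) * a - 2) * |v x| ^ ((n : ℝ) * a - 2)) := by
  set k : Fin n := ⟨n - 1, by omega⟩ with hk
  obtain rfl : v = powerBarrier k a A B := hv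
  have hnorm : ∀ x ∈ closure Ω, ‖x‖ ≤ D := fun x hx => by
    rw [hD, ← Metric.diam_closure, ← dist_zero_right]
    exact Metric.dist_le_diam_of_mem hΩb.closure hx (frontier_subset_closure h0)
  have hcl : ∀ x ∈ closure Ω, 0 ≤ x k := fun x hx =>
    closure_minimal (fun y hy => (hΩpos y hy).le)
      (isClosed_le continuous_const (EuclideanSpace.proj (𝕜 := ℝ) k).continuous) hx
  have hAmul : (a - 1) * A = 1 + (a + 1) * D ^ 2 := by
    rw [hA]; field_simp [(sub_pos.2 ha).ne']
  have hA0 : 0 < A := by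
    rw [hA]; exact div_pos (by nlinarith [sq_nonneg D]) (by linarith)
  have hsum : ∀ x ∈ Ω, 1 ≤ (a - 1) * A - (a + 1) * ∑ i ∈ Finset.univ.erase k, x i ^ 2 :=
    fun x hx => by
      nlinarith [sum_erase_sq_le k (hnorm x (subset_closure hx))]
  have hdom : ∀ x ∈ closure Ω,
      x k ^ a * ((∑ i ∈ Finset.univ.erase k, x i ^ 2) + A) ≤ B * x k := fun x hx =>
    hB ▸ rpow_mul_le_of_norm_le k ha hA0.le (hcl x hx) (hnorm x hx)
  have hnonpos : ∀ x ∈ closure Ω, powerBarrier k a A B x ≤ 0 := fun x hx =>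
    sub_nonpos.2 (hdom x hx)
  refine ⟨?_, ?_, ?_, hnonpos, fun x hx => ⟨?_, ?_⟩⟩
  · have hC : ContDiff ℝ 1 (powerBarrier k a A B) := contDiff_iff_contDiffAt.2 fun x =>
      contDiffAt_powerBarrier A B
        (Real.contDiff_rpow_const_of_le (n := 1) (by simpa using ha.le)).contDiffAt
    exact hC.locallyLipschitz.locallyLipschitzOn.exists_lipschitzOnWith_of_compact
      hΩb.isCompact_closure
  · exact fun x hx => (contDiffAt_powerBarrier A B
      (Real.contDiffAt_rpow_const_of_ne (hΩpos x hx).ne')).contDiffWithinAt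
  · exact convexOn_powerBarrier k ha B hΩc hΩpos fun x hx => by linarith [hsum x hx]
  · obtain ⟨m, rfl⟩ : ∃ m, n = m + 1 := ⟨n - 1, by omega⟩
    have hxk : 0 < x k := hΩpos x hx
    have hpos : 0 < (2 : ℝ) ^ m * a * x k ^ (((m + 1 : ℕ) : ℝ) * a - 2) := by positivity
    refine le_of_le_of_eq ?_ (hessianDet_powerBarrier (m := m) ha.le A B hxk).symm
    exact le_mul_of_one_le_right hpos.le (hsum x hx)
  · have hxk : 0 < x k := hΩpos x hx
    have hDpos : 0 < D := by
      refine (norm_pos_iff.2 ?_).trans_le (hnorm x (subset_closure hx))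
      rintro rfl
      simp at hxk
    have hBpos : 0 < B := by rw [hB]; positivity
    have hexp : 0 ≤ (n : ℝ) * a - 2 := by
      have : (2 : ℝ) ≤ n := by exact_mod_cast hn
      nlinarith
    have habs : |powerBarrier k a A B x| ≤ B * x k := by
      rw [abs_of_nonpos (hnonpos x (subset_closure hx)), powerBarrier, neg_sub]
      refine sub_le_self _ ?_
      have : 0 ≤ ∑ i ∈ Finset.univ.erase k, x i ^ 2 := Finset.sum_nonneg fun i _ => sq_nonneg _
      positivity
    have hpow : |powerBarrier k a A B x| ^ ((n : ℝ) * a - 2) ≤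
        B ^ ((n : ℝ) * a - 2) * x k ^ ((n : ℝ) * a - 2) := by
      rw [← Real.mul_rpow hBpos.le hxk.le]
      exact Real.rpow_le_rpow (abs_nonneg _) habs hexp
    rw [ge_iff_le, div_mul_eq_mul_div, div_le_iff₀ (by positivity)]
    calc _ ≤ (2 : ℝ) ^ (n - 1) * a *
          (B ^ ((n : ℝ) * a - 2) * x k ^ ((n : ℝ) * a - 2)) := by gcongr
      _ = _ := by ring
end

section
/- Let n ≥ 2 and D > 0. There exists a constant c > 0 depending only on n and D such that the following holds. Let Ω ⊂ ℝⁿ be a bounded open convex set with diam(Ω) = D, let u : Ω → ℝ be four times continuously differentiable with D²u(x) positive definite for every x ∈ Ω, let U(x) = det D²u(x) · (D²u(x))^{-1} be the cofactor (adjugate) matrix of D²u(x), and set w = (det D²u)^{-1} on Ω. Assume that w extends continuously to the closure of Ω with w = 0 on ∂Ω, and that there is a bounded measurable function f : Ω → ℝ with F := sup_Ω max(f, 0) > 0 such that Σ_{i,j} U^{ij}(x) ∂²w/∂xᵢ∂xⱼ(x) = −f(x) for all x ∈ Ω. Then det D²u(x) ≥ c · F^{−n} · [dist(x, ∂Ω)]^{−1}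 for all x ∈ Ω. -/
open Metric MeasureTheory Real

open scoped MatrixOrder ComplexOrder in
theorem Matrix.PosSemidef.exists_eq_transpose_mul_self {ι : Type*} [Fintype ι] [DecidableEq ι]
    {U : Matrix ι ι ℝ} (hU : U.PosSemidef) : ∃ C : Matrix ι ι ℝ, U = C.transpose * C := by
  obtain ⟨C, hC⟩ := CStarAlgebra.nonneg_iff_eq_star_mul_self.mp hU.nonneg
  exact ⟨C, by simpa [Matrix.star_eq_conjTranspose] using hC⟩

theorem Matrix.sum_mul_transpose_mul_self {ι : Type*} [Fintype ι] (C A : Matrix ι ι ℝ) :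
    ∑ i, ∑ j, (C.transpose * C) i j * A i j = ∑ k, ∑ i, ∑ j, A i j * C k i * C k j := by
  have h : ∀ i j, (C.transpose * C) i j * A i j = ∑ k, A i j * C k i * C k j := by
    intro i j
    rw [Matrix.mul_apply, Finset.sum_mul]
    exact Finset.sum_congr rfl fun k _ => by rw [Matrix.transpose_apply]; ring
  simp_rw [h]
  rw [Finset.sum_comm]
  conv_lhs => enter [2, j]; rw [Finset.sum_comm]
  rw [Finset.sum_comm]
  exact Finset.sum_congr rfl fun k _ => Finset.sum_comm

theorem Matrix.PosSemidef.sum_mul_le_of_forall_quadratic_le {ι : Type*} [Fintype ι] [DecidableEq ι]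
    {U A B : Matrix ι ι ℝ} (hU : U.PosSemidef)
    (h : ∀ ξ : ι → ℝ, ∑ i, ∑ j, A i j * ξ i * ξ j ≤ ∑ i, ∑ j, B i j * ξ i * ξ j) :
    ∑ i, ∑ j, U i j * A i j ≤ ∑ i, ∑ j, U i j * B i j := by
  obtain ⟨C, rfl⟩ := hU.exists_eq_transpose_mul_self
  rw [Matrix.sum_mul_transpose_mul_self, Matrix.sum_mul_transpose_mul_self]
  exact Finset.sum_le_sum fun k _ => h (C k)

theorem Matrix.PosSemidef.det_le_trace_pow {ι : Type*} [Fintype ι] [DecidableEq ι]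
    {M : Matrix ι ι ℝ} (hM : M.PosSemidef) : M.det ≤ M.trace ^ Fintype.card ι := by
  rw [hM.1.det_eq_prod_eigenvalues, hM.1.trace_eq_sum_eigenvalues, ← Finset.card_univ,
    ← Finset.prod_const]
  exact Finset.prod_le_prod (fun i _ => by simpa using hM.eigenvalues_nonneg i) fun i _ =>
    Finset.single_le_sum (f := fun i => (hM.1.eigenvalues i : ℝ))
      (fun j _ => hM.eigenvalues_nonneg j) (Finset.mem_univ i)

theorem Matrix.PosSemidef.det_mul_det_le_sum_pow {ι : Type*} [Fintype ι] [DecidableEq ι]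
    {U P : Matrix ι ι ℝ} (hU : U.PosSemidef) (hP : P.PosSemidef) :
    U.det * P.det ≤ (∑ i, ∑ j, U i j * P i j) ^ Fintype.card ι := by
  obtain ⟨C, rfl⟩ := hU.exists_eq_transpose_mul_self
  have hM : (C * P * C.transpose).PosSemidef := by
    simpa using hP.mul_mul_conjTranspose_same C
  have ht : (C * P * C.transpose).trace =
      ∑ i, ∑ j, (C.transpose * C) i j * P i j := by
    rw [Matrix.sum_mul_transpose_mul_self, Matrix.trace]
    refine Finset.sum_congr rfl fun k _ => ?_
    rw [Matrix.diag_apply, Matrix.mul_apply, Finset.sum_comm]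
    refine Finset.sum_congr rfl fun j _ => ?_
    rw [Matrix.mul_apply, Finset.sum_mul]
    exact Finset.sum_congr rfl fun i _ => by rw [Matrix.transpose_apply]; ring
  rw [← ht]
  refine le_trans (le_of_eq ?_) hM.det_le_trace_pow
  simp only [Matrix.det_mul, Matrix.det_transpose]
  ring

theorem Matrix.det_det_smul_inv {ι : Type*} [Fintype ι] [DecidableEq ι] {H : Matrix ι ι ℝ}
    (hH : H.det ≠ 0) (hι : 1 ≤ Fintype.card ι) :
    (H.det • H⁻¹).det = H.det ^ (Fintype.card ι - 1) := by
  rw [Matrix.det_smul, Matrix.det_nonsing_inv, Ring.inverse_eq_inv']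
  obtain ⟨m, hm⟩ := Nat.exists_eq_add_of_le hι
  rw [hm, Nat.add_sub_cancel_left, pow_add, pow_one]
  field_simp

/-- The model matrix `a I + b ν νᵀ`. -/
def scalarAddRankOne {n : ℕ} (a b : ℝ) (ν : EuclideanSpace ℝ (Fin n)) : Matrix (Fin n) (Fin n) ℝ :=
  a • (1 : Matrix (Fin n) (Fin n) ℝ) + b • Matrix.vecMulVec ν ν

theorem scalarAddRankOne_quadratic {n : ℕ} (a b : ℝ) (ν ξ : EuclideanSpace ℝ (Fin n)) :
    ∑ i, ∑ j, scalarAddRankOne a b ν i j * ξ i * ξ j = a * ‖ξ‖ ^ 2 + b * inner ℝ ν ξ ^ 2 := by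
  have h : ∀ i j, scalarAddRankOne a b ν i j * ξ i * ξ j =
      (if i = j then a * (ξ i * ξ j) else 0) + b * ((ν i * ξ i) * (ν j * ξ j)) := by
    intro i j
    simp only [scalarAddRankOne, Matrix.add_apply, Matrix.smul_apply, Matrix.one_apply,
      Matrix.vecMulVec_apply, smul_eq_mul]
    split_ifs <;> ring
  simp_rw [h, Finset.sum_add_distrib, Finset.sum_ite_eq, ← Finset.mul_sum, ← Finset.sum_mul]
  rw [EuclideanSpace.real_norm_sq_eq, PiLp.inner_apply]
  simp [Finset.mul_sum, sq, mul_comm]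

theorem scalarAddRankOne_posSemidef {n : ℕ} {a b : ℝ} (ha : 0 ≤ a) (hb : 0 ≤ b)
    (ν : EuclideanSpace ℝ (Fin n)) : (scalarAddRankOne a b ν).PosSemidef := by
  refine (Matrix.PosSemidef.one.smul ha).add (Matrix.PosSemidef.smul ?_ hb)
  simpa using Matrix.posSemidef_vecMulVec_self_star (ν : Fin n → ℝ)

theorem scalarAddRankOne_det {n : ℕ} {a b : ℝ} (ha : a ≠ 0)
    {ν : EuclideanSpace ℝ (Fin n)} (hν : ‖ν‖ = 1) :
    (scalarAddRankOne a b ν).det = a ^ n * (1 + b / a) := by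
  have h : scalarAddRankOne a b ν = a • (1 + Matrix.replicateCol Unit ((b / a) • (ν : Fin n → ℝ)) *
      Matrix.replicateRow Unit (ν : Fin n → ℝ)) := by
    ext i j
    simp [scalarAddRankOne, Matrix.vecMulVec_apply, Matrix.mul_apply]
    field_simp
  rw [h, Matrix.det_smul, Matrix.det_one_add_replicateCol_mul_replicateRow, Fintype.card_fin]
  have h1 : (ν : Fin n → ℝ) ⬝ᵥ (ν : Fin n → ℝ) = 1 := by
    have := EuclideanSpace.real_norm_sq_eq ν
    rw [hν] at this
    simp only [dotProduct, ← sq, ← this]; norm_num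
  rw [dotProduct_smul, h1]; simp

open Topology in
theorem IsLocalMax.second_deriv_nonpos {g g' : ℝ → ℝ} {a c : ℝ} (hmax : IsLocalMax g a)
    (h1 : ∀ᶠ τ in 𝓝 a, HasDerivAt g (g' τ) τ) (h2 : HasDerivAt g' c a) : c ≤ 0 := by
  by_contra! hc
  have he : deriv g =ᶠ[𝓝 a] g' := h1.mono fun τ h => h.deriv
  have hd : deriv (deriv g) a = c := he.deriv_eq.trans h2.deriv
  have hmin : IsLocalMin g a :=
    isLocalMin_of_deriv_deriv_pos (hd ▸ hc) hmax.deriv_eq_zero h1.self_of_nhds.continuousAt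
  have hconst : g =ᶠ[𝓝 a] fun _ => g a := by
    filter_upwards [hmax, hmin] with τ h h' using le_antisymm h h'
  have hd0 : deriv (deriv g) a = 0 := by
    rw [hconst.deriv.deriv_eq]; simp
  linarith

open Topology in
theorem ContDiffAt.hasDerivAt_line {E : Type*} [NormedAddCommGroup E] [NormedSpace ℝ E]
    {w : E → ℝ} {x : E} (hw : ContDiffAt ℝ 2 w x) (ξ : E) :
    (∀ᶠ τ : ℝ in 𝓝 0, HasDerivAt (fun τ : ℝ => w (x + τ • ξ)) (fderiv ℝ w (x + τ • ξ) ξ) τ) ∧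
      HasDerivAt (fun τ : ℝ => fderiv ℝ w (x + τ • ξ) ξ) (fderiv ℝ (fderiv ℝ w) x ξ ξ) 0 := by
  have hline : ∀ τ : ℝ, HasDerivAt (fun τ : ℝ => x + τ • ξ) ξ τ := fun τ => by
    simpa using ((hasDerivAt_id τ).smul_const ξ).const_add x
  have hcont : Filter.Tendsto (fun τ : ℝ => x + τ • ξ) (𝓝 0) (𝓝 x) := by
    simpa using (hline 0).continuousAt.tendsto
  constructor
  · have h : ∀ᶠ y in 𝓝 x, DifferentiableAt ℝ w y :=
      (hw.eventually (by simp)).mono fun y hy => hy.differentiableAt (by simp)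
    filter_upwards [hcont.eventually h] with τ hτ
    exact hτ.hasFDerivAt.comp_hasDerivAt τ (hline τ)
  · have h : DifferentiableAt ℝ (fderiv ℝ w) x :=
      (hw.fderiv_right (m := 1) (by norm_num)).differentiableAt (by simp)
    have h' : HasFDerivAt (fderiv ℝ w) (fderiv ℝ (fderiv ℝ w) x) (x + (0 : ℝ) • ξ) := by
      simpa using h.hasFDerivAt
    have h2 : HasDerivAt (fun τ : ℝ => fderiv ℝ w (x + τ • ξ)) (fderiv ℝ (fderiv ℝ w) x ξ) 0 :=
      h'.comp_hasDerivAt (0 : ℝ) (hline 0)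
    exact (ContinuousLinearMap.apply ℝ ℝ ξ).hasFDerivAt.comp_hasDerivAt (0 : ℝ) h2

theorem hessianMatrix_quadratic {n : ℕ} {w : EuclideanSpace ℝ (Fin n) → ℝ}
    {x : EuclideanSpace ℝ (Fin n)} (hw : ContDiffAt ℝ 2 w x) (ξ : EuclideanSpace ℝ (Fin n)) :
    ∑ i, ∑ j, hessianMatrix w x i j * ξ i * ξ j = fderiv ℝ (fderiv ℝ w) x ξ ξ := by
  have h : DifferentiableAt ℝ (fderiv ℝ w) x :=
    (hw.fderiv_right (m := 1) (by norm_num)).differentiableAt (by simp)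
  have hij : ∀ i j, hessianMatrix w x i j =
      fderiv ℝ (fderiv ℝ w) x (EuclideanSpace.single i 1) (EuclideanSpace.single j 1) := by
    intro i j
    rw [hessianMatrix, Matrix.of_apply, fderiv_clm_apply h (differentiableAt_const _)]
    simp
  have hξ : ξ = ∑ i, ξ i • EuclideanSpace.single i (1 : ℝ) := by
    ext k
    simp [Finset.sum_apply, Pi.single_apply]
  conv_rhs => rw [hξ]
  simp only [map_sum, map_smul, sum_apply, smul_apply,
    smul_eq_mul, hij, Finset.mul_sum]
  rw [Finset.sum_comm]
  exact Finset.sum_congr rfl fun i _ => Finset.sum_congr rfl fun j _ => by ring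

theorem contDiffOn_hessianMatrix {n : ℕ} {u : EuclideanSpace ℝ (Fin n) → ℝ}
    {Ω : Set (EuclideanSpace ℝ (Fin n))} (hΩ : IsOpen Ω) (hu : ContDiffOn ℝ 4 u Ω) (i j : Fin n) :
    ContDiffOn ℝ 2 (fun x => hessianMatrix u x i j) Ω := by
  have h1 : ContDiffOn ℝ 3 (fun y => fderiv ℝ u y (EuclideanSpace.single j 1)) Ω :=
    (hu.fderiv_of_isOpen hΩ (by norm_num)).clm_apply contDiffOn_const
  exact (h1.fderiv_of_isOpen hΩ (by norm_num)).clm_apply contDiffOn_const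

theorem contDiffOn_inv_det_hessianMatrix {n : ℕ} {u : EuclideanSpace ℝ (Fin n) → ℝ}
    {Ω : Set (EuclideanSpace ℝ (Fin n))} (hΩ : IsOpen Ω) (hu : ContDiffOn ℝ 4 u Ω)
    (hpos : ∀ x ∈ Ω, (hessianMatrix u x).det ≠ 0) :
    ContDiffOn ℝ 2 (fun x => ((hessianMatrix u x).det)⁻¹) Ω := by
  refine ContDiffOn.inv ?_ hpos
  simp only [Matrix.det_apply]
  exact ContDiffOn.sum fun σ _ => (contDiffOn_prod fun i _ =>
    contDiffOn_hessianMatrix hΩ hu (σ i) i).const_smul (Equiv.Perm.sign σ)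

/-- A positive function on the half space `⟪ν, y - z⟫ + ε > 0`, linear up to lower order at its
boundary, whose Hessian degenerates there at a controlled rate. -/
noncomputable def halfSpaceBarrier {n : ℕ} (A B α ε : ℝ) (z ν y : EuclideanSpace ℝ (Fin n)) : ℝ :=
  A * (inner ℝ ν (y - z) + ε) - (inner ℝ ν (y - z) + ε) ^ α * (B + ‖y - z‖ ^ 2)

open Topology in
theorem hasDerivAt_line_barrier (A B α s σ r b X : ℝ) (hs : 0 < s) :
    ∃ g' : ℝ → ℝ, (∀ᶠ τ : ℝ in 𝓝 0, HasDerivAt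
      (fun τ : ℝ => A * (s + τ * σ) - (s + τ * σ) ^ α * (B + (r + 2 * τ * b + τ ^ 2 * X)))
        (g' τ) τ) ∧
      HasDerivAt g' (-(α * (α - 1) * s ^ (α - 2) * σ ^ 2 * (B + r) +
        4 * α * s ^ (α - 1) * σ * b + 2 * s ^ α * X)) 0 := by
  have hlin : ∀ τ : ℝ, HasDerivAt (fun τ : ℝ => s + τ * σ) σ τ := fun τ => by
    simpa using ((hasDerivAt_id τ).mul_const σ).const_add s
  have hpow : ∀ β τ : ℝ, 0 < s + τ * σ →
      HasDerivAt (fun τ : ℝ => (s + τ * σ) ^ β) (σ * β * (s + τ * σ) ^ (β - 1)) τ :=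
    fun β τ h => (hlin τ).rpow_const (Or.inl h.ne')
  have hq : ∀ τ : ℝ, HasDerivAt (fun τ : ℝ => B + (r + 2 * τ * b + τ ^ 2 * X))
      (2 * b + 2 * τ * X) τ := fun τ => by
    have h1 := (((hasDerivAt_id τ).const_mul 2).mul_const b).const_add r
    have h2 := (((hasDerivAt_id τ).pow 2).mul_const X)
    exact ((h1.add h2).const_add B).congr_deriv (by simp)
  have hq' : ∀ τ : ℝ, HasDerivAt (fun τ : ℝ => 2 * b + 2 * τ * X) (2 * X) τ := fun τ => by
    simpa using (((hasDerivAt_id τ).const_mul 2).mul_const X).const_add (2 * b)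
  refine ⟨fun τ => A * σ - (σ * α * (s + τ * σ) ^ (α - 1) * (B + (r + 2 * τ * b + τ ^ 2 * X)) +
    (s + τ * σ) ^ α * (2 * b + 2 * τ * X)), ?_, ?_⟩
  · have : ∀ᶠ τ : ℝ in 𝓝 0, 0 < s + τ * σ :=
      (hlin 0).continuousAt.eventually (lt_mem_nhds (by simpa using hs))
    filter_upwards [this] with τ hτ
    exact ((hlin τ).const_mul A).sub ((hpow α τ hτ).mul (hq τ))
  · have h0 : 0 < s + 0 * σ := by simpa using hs
    refine (((((hpow (α - 1) 0 h0).const_mul (σ * α)).mul (hq 0)).add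
      ((hpow α 0 h0).mul (hq' 0))).const_sub (A * σ)).congr_deriv ?_
    rw [show α - 1 - 1 = α - 2 by ring]
    simp only [zero_mul, add_zero, mul_zero]
    ring

theorem barrier_quadratic_bound {α B s σ r b X D : ℝ} (hs : 0 < s) (hα : 1 < α) (hα2 : α ≤ 3 / 2)
    (hB : 1 + 9 * D ^ 2 ≤ (α - 1) * B) (hr : 0 ≤ r) (hrD : r ≤ D)
    (hb : |b| ≤ r * X) :
    s ^ α * X ^ 2 + s ^ (α - 2) * σ ^ 2 ≤
      α * (α - 1) * s ^ (α - 2) * σ ^ 2 * (B + r ^ 2) + 4 * α * s ^ (α - 1) * σ * b +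
        2 * s ^ α * X ^ 2 := by
  have hp : 0 < s ^ (α - 2) := rpow_pos_of_pos hs _
  have h1 : s ^ (α - 1) = s ^ (α - 2) * s := by
    rw [← rpow_add_one hs.ne']; ring_nf
  have h2 : s ^ α = s ^ (α - 2) * s ^ 2 := by
    rw [← rpow_add_natCast hs.ne']; norm_num
  rw [h1, h2]
  have hcross : -(|σ| * s * (r * X)) ≤ s * σ * b := by
    have h3 : |s * σ * b| ≤ |σ| * s * (r * X) := by
      rw [abs_mul, abs_mul, abs_of_pos hs, mul_comm s]
      gcongr
    exact (abs_le.mp h3).1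
  have hr2 : r ^ 2 ≤ D ^ 2 := by gcongr
  have hcoef : 1 + 9 * r ^ 2 ≤ α * (α - 1) * (B + r ^ 2) := by
    have : 0 ≤ (α - 1) * r ^ 2 := by nlinarith [sq_nonneg r]
    nlinarith [sq_nonneg D]
  have hα9 : 4 * α ^ 2 * r ^ 2 ≤ 9 * r ^ 2 := by
    gcongr
    nlinarith
  have hσ : (1 + 4 * α ^ 2 * r ^ 2) * σ ^ 2 ≤ α * (α - 1) * (B + r ^ 2) * σ ^ 2 := by
    gcongr
    linarith
  have hkey : 0 ≤ α * (α - 1) * σ ^ 2 * (B + r ^ 2) + 4 * α * (s * σ * b) + s ^ 2 * X ^ 2 - σ ^ 2 := by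
    have h4 : 4 * α * -(|σ| * s * (r * X)) ≤ 4 * α * (s * σ * b) := by gcongr
    nlinarith [sq_nonneg (s * X - 2 * α * r * |σ|), sq_abs σ]
  nlinarith [mul_nonneg hp.le hkey]

open Topology in
theorem hessianMatrix_le_of_isLocalMax_sub_barrier {n : ℕ} {A B α ε D t : ℝ}
    {w : EuclideanSpace ℝ (Fin n) → ℝ} {z ν y : EuclideanSpace ℝ (Fin n)}
    (hw : ContDiffAt ℝ 2 w y) (ht : 0 ≤ t)
    (hmax : IsLocalMax (fun y => w y - t * halfSpaceBarrier A B α ε z ν y) y)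
    (hs : 0 < inner ℝ ν (y - z) + ε) (hα : 1 < α) (hα2 : α ≤ 3 / 2)
    (hB : 1 + 9 * D ^ 2 ≤ (α - 1) * B) (hD : ‖y - z‖ ≤ D) (ξ : EuclideanSpace ℝ (Fin n)) :
    ∑ i, ∑ j, hessianMatrix w y i j * ξ i * ξ j ≤
      -t * ((inner ℝ ν (y - z) + ε) ^ α * ‖ξ‖ ^ 2 +
        (inner ℝ ν (y - z) + ε) ^ (α - 2) * inner ℝ ν ξ ^ 2) := by
  rw [hessianMatrix_quadratic hw]
  obtain ⟨hw1, hw2⟩ := hw.hasDerivAt_line ξ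
  obtain ⟨g', hg1, hg2⟩ := hasDerivAt_line_barrier A B α (inner ℝ ν (y - z) + ε) (inner ℝ ν ξ)
    (‖y - z‖ ^ 2) (inner ℝ (y - z) ξ) (‖ξ‖ ^ 2) hs
  have hline : ∀ τ : ℝ, halfSpaceBarrier A B α ε z ν (y + τ • ξ) =
      A * (inner ℝ ν (y - z) + ε + τ * inner ℝ ν ξ) -
        (inner ℝ ν (y - z) + ε + τ * inner ℝ ν ξ) ^ α *
          (B + (‖y - z‖ ^ 2 + 2 * τ * inner ℝ (y - z) ξ + τ ^ 2 * ‖ξ‖ ^ 2)) := by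
    intro τ
    rw [halfSpaceBarrier, show y + τ • ξ - z = (y - z) + τ • ξ by abel, inner_add_right,
      norm_add_sq_real, inner_smul_right, inner_smul_right, norm_smul, mul_pow, Real.norm_eq_abs,
      sq_abs]
    ring_nf
  have hmax' : IsLocalMax
      (fun τ : ℝ => w (y + τ • ξ) - t * halfSpaceBarrier A B α ε z ν (y + τ • ξ)) 0 := by
    have hc : Filter.Tendsto (fun τ : ℝ => y + τ • ξ) (𝓝 0) (𝓝 y) := by
      have : Continuous fun τ : ℝ => y + τ • ξ := by fun_prop
      simpa using this.tendsto 0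
    have := hc.eventually hmax
    simpa [IsLocalMax, IsMaxFilter] using this
  simp only [hline] at hmax'
  have h := hmax'.second_deriv_nonpos
    (by filter_upwards [hw1, hg1] with τ h h' using h.sub (h'.const_mul t))
    (hw2.sub (hg2.const_mul t))
  have hq := barrier_quadratic_bound (σ := inner ℝ ν ξ) hs hα hα2 hB (norm_nonneg (y - z)) hD
    (abs_real_inner_le_norm (y - z) ξ)
  nlinarith [mul_le_mul_of_nonneg_left hq ht]

theorem barrier_slope_le {m : ℕ} {H M : Matrix (Fin (m + 1)) (Fin (m + 1)) ℝ} {A F t s : ℝ}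
    {ν : EuclideanSpace ℝ (Fin (m + 1))} (hH : H.PosDef) (hν : ‖ν‖ = 1) (hs : 0 < s) (ht : 0 ≤ t)
    (hA : 0 ≤ A)
    (hM : ∀ ξ : EuclideanSpace ℝ (Fin (m + 1)), ∑ i, ∑ j, M i j * ξ i * ξ j ≤
      -t * (s ^ (1 + 1 / (m + 1 : ℝ)) * ‖ξ‖ ^ 2 +
        s ^ (1 + 1 / (m + 1 : ℝ) - 2) * inner ℝ ν ξ ^ 2))
    (hF : -F ≤ ∑ i, ∑ j, (H.det • H⁻¹) i j * M i j) (hdet : H.det⁻¹ ≤ t * (A * s)) :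
    t ≤ A ^ m * F ^ (m + 1) := by
  set α : ℝ := 1 + 1 / (m + 1 : ℝ) with hα
  set P := scalarAddRankOne (s ^ α) (s ^ (α - 2)) ν with hPdef
  have hdpos : 0 < H.det := hH.det_pos
  have hU : (H.det • H⁻¹).PosSemidef := hH.posSemidef.inv.smul hdpos.le
  have hsα : 0 < s ^ α := rpow_pos_of_pos hs _
  have hP : P.PosSemidef := scalarAddRankOne_posSemidef hsα.le (rpow_pos_of_pos hs _).le ν
  have htr : ∑ i, ∑ j, (H.det • H⁻¹) i j * M i j ≤
      -t * ∑ i, ∑ j, (H.det • H⁻¹) i j * P i j := by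
    have h := hU.sum_mul_le_of_forall_quadratic_le (A := M) (B := (-t) • P) fun ξ => by
      have h1 := hM (WithLp.toLp 2 ξ)
      rw [← scalarAddRankOne_quadratic] at h1
      simpa [Finset.mul_sum, mul_assoc] using h1
    refine h.trans (le_of_eq ?_)
    simp only [Finset.mul_sum, Matrix.smul_apply, smul_eq_mul]
    exact Finset.sum_congr rfl fun i _ => Finset.sum_congr rfl fun j _ => by ring
  have hdetP : s ^ m ≤ P.det := by
    rw [hPdef, scalarAddRankOne_det hsα.ne' hν]
    have h1 : (s ^ α) ^ (m + 1) = s ^ m * s ^ 2 := by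
      rw [← rpow_mul_natCast hs.le, ← pow_add, ← rpow_natCast]
      congr 1
      rw [hα]
      push_cast
      field_simp
      ring
    have h2 : s ^ (α - 2) / s ^ α = (s ^ 2)⁻¹ := by
      rw [← rpow_sub hs, show α - 2 - α = -(2 : ℕ) by push_cast; ring, rpow_neg hs.le,
        rpow_natCast]
    rw [h1, h2]
    have : s ^ m * s ^ 2 * (1 + (s ^ 2)⁻¹) = s ^ m * s ^ 2 + s ^ m := by field_simp
    rw [this]
    have : 0 ≤ s ^ m * s ^ 2 := by positivity
    linarith
  have hdd := hU.det_mul_det_le_sum_pow hP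
  rw [Matrix.det_det_smul_inv hdpos.ne' (by simp), Fintype.card_fin, Nat.add_sub_cancel] at hdd
  have htF : t ^ (m + 1) * (H.det ^ m * s ^ m) ≤ F ^ (m + 1) := by
    have hdd' : H.det ^ m * s ^ m ≤ (∑ i, ∑ j, (H.det • H⁻¹) i j * P i j) ^ (m + 1) :=
      le_trans (by gcongr) hdd
    have h0 : 0 ≤ ∑ i, ∑ j, (H.det • H⁻¹) i j * P i j := by
      have h := hU.sum_mul_le_of_forall_quadratic_le (A := 0) (B := P) fun ξ => by
        have h1 := scalarAddRankOne_quadratic (s ^ α) (s ^ (α - 2)) ν (WithLp.toLp 2 ξ)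
        have h2 : 0 ≤ s ^ α * ‖WithLp.toLp 2 ξ‖ ^ 2 +
            s ^ (α - 2) * inner ℝ ν (WithLp.toLp 2 ξ) ^ 2 := by positivity
        rw [← h1] at h2
        simpa using h2
      simpa using h
    calc t ^ (m + 1) * (H.det ^ m * s ^ m)
        ≤ t ^ (m + 1) * (∑ i, ∑ j, (H.det • H⁻¹) i j * P i j) ^ (m + 1) := by gcongr
      _ = (t * ∑ i, ∑ j, (H.det • H⁻¹) i j * P i j) ^ (m + 1) := by rw [mul_pow]
      _ ≤ F ^ (m + 1) := by
        gcongr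
        linarith
  have hone : 1 ≤ (H.det * (t * (A * s))) ^ m := by
    refine one_le_pow₀ ?_
    rw [← mul_inv_cancel₀ hdpos.ne']
    gcongr
  calc t ≤ t * (H.det * (t * (A * s))) ^ m := le_mul_of_one_le_right ht hone
    _ = A ^ m * (t ^ (m + 1) * (H.det ^ m * s ^ m)) := by ring
    _ ≤ A ^ m * F ^ (m + 1) := by gcongr

theorem Convex.exists_unit_supporting_normal {E : Type*} [NormedAddCommGroup E]
    [InnerProductSpace ℝ E] [CompleteSpace E] {Ω : Set E} (hc : Convex ℝ Ω) (ho : IsOpen Ω)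
    (hne : Ω.Nonempty) {z : E} (hz : z ∉ Ω) :
    ∃ ν : E, ‖ν‖ = 1 ∧ ∀ y ∈ closure Ω, 0 ≤ inner ℝ ν (y - z) := by
  obtain ⟨f, hf⟩ := geometric_hahn_banach_point_open hc ho hz
  set ν := (InnerProductSpace.toDual ℝ E).symm f with hνdef
  have hν : ∀ y, inner ℝ ν y = f y := fun y => InnerProductSpace.toDual_symm_apply
  have hν0 : ν ≠ 0 := by
    intro h
    obtain ⟨y, hy⟩ := hne
    have h1 := hf y hy
    rw [← hν, ← hν, h] at h1
    simp at h1
  refine ⟨‖ν‖⁻¹ • ν, by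
    rw [norm_smul, norm_inv, norm_norm, inv_mul_cancel₀ (norm_ne_zero_iff.mpr hν0)], ?_⟩
  have hcl : IsClosed {y : E | 0 ≤ inner ℝ (‖ν‖⁻¹ • ν) (y - z)} :=
    isClosed_le continuous_const (by fun_prop)
  refine fun y hy => closure_minimal (fun y hy => ?_) hcl hy
  rw [Set.mem_ofPred_eq, real_inner_smul_left, inner_sub_right, hν, hν]
  have := hf y hy
  exact mul_nonneg (by positivity) (by linarith)

theorem halfSpaceBarrier_bounds {n : ℕ} {B D β ε : ℝ} {z ν y : EuclideanSpace ℝ (Fin n)}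
    (hB : 0 ≤ B) (hβ : 0 ≤ β) (hν : ‖ν‖ = 1) (hD : ‖y - z‖ ≤ D) (hε : ε ≤ 1)
    (hs : 0 < inner ℝ ν (y - z) + ε) :
    inner ℝ ν (y - z) + ε ≤
        halfSpaceBarrier ((D + 1) ^ β * (B + D ^ 2) + 1) B (1 + β) ε z ν y ∧
      halfSpaceBarrier ((D + 1) ^ β * (B + D ^ 2) + 1) B (1 + β) ε z ν y ≤
        ((D + 1) ^ β * (B + D ^ 2) + 1) * (inner ℝ ν (y - z) + ε) := by
  have hle : inner ℝ ν (y - z) + ε ≤ D + 1 := by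
    have := real_inner_le_norm ν (y - z)
    rw [hν, one_mul] at this
    linarith
  rw [halfSpaceBarrier]
  set s := inner ℝ ν (y - z) + ε
  constructor
  · have h : s ^ (1 + β) * (B + ‖y - z‖ ^ 2) ≤ s * (D + 1) ^ β * (B + D ^ 2) := by
      rw [rpow_add hs, rpow_one]
      gcongr
      exact mul_nonneg hs.le (rpow_nonneg (by linarith) _)
    linarith
  · have : 0 ≤ s ^ (1 + β) * (B + ‖y - z‖ ^ 2) := by positivity
    linarith

open Topology in
theorem inv_det_hessianMatrix_le_of_supporting_normal {m : ℕ} {D ε F A B : ℝ}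
    {Ω : Set (EuclideanSpace ℝ (Fin (m + 1)))} {u W : EuclideanSpace ℝ (Fin (m + 1)) → ℝ}
    {z ν : EuclideanSpace ℝ (Fin (m + 1))} (hm : 1 ≤ m)
    (hB : B = (m + 1) * (1 + 9 * D ^ 2))
    (hA : A = (D + 1) ^ (1 / (m + 1 : ℝ)) * (B + D ^ 2) + 1)
    (hΩ : IsOpen Ω) (hbd : Bornology.IsBounded Ω) (hu : ContDiffOn ℝ 4 u Ω)
    (hpos : ∀ x ∈ Ω, (hessianMatrix u x).PosDef)
    (hF : ∀ x ∈ Ω, -F ≤ ∑ i, ∑ j, ((hessianMatrix u x).det • (hessianMatrix u x)⁻¹) i j *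
      hessianMatrix (fun y => ((hessianMatrix u y).det)⁻¹) x i j)
    (hWc : ContinuousOn W (closure Ω)) (hW : ∀ x ∈ Ω, W x = ((hessianMatrix u x).det)⁻¹)
    (hW0 : ∀ x ∈ frontier Ω, W x = 0)
    (hν : ‖ν‖ = 1) (hsupp : ∀ y ∈ closure Ω, 0 ≤ inner ℝ ν (y - z))
    (hD : ∀ y ∈ closure Ω, ‖y - z‖ ≤ D) (hε : 0 < ε) (hε1 : ε ≤ 1)
    {x : EuclideanSpace ℝ (Fin (m + 1))} (hx : x ∈ Ω) :
    ((hessianMatrix u x).det)⁻¹ ≤ A ^ (m + 1) * F ^ (m + 1) * (inner ℝ ν (x - z) + ε) := by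
  have hB0 : 0 ≤ B := by rw [hB]; positivity
  have hD0 : 0 ≤ D := (norm_nonneg _).trans (hD x (subset_closure hx))
  have hA0 : 0 ≤ A := by rw [hA]; positivity
  have hm1 : (2 : ℝ) ≤ m + 1 := by exact_mod_cast Nat.succ_le_succ hm
  set α : ℝ := 1 + 1 / (m + 1 : ℝ) with hα
  have hs : ∀ y ∈ closure Ω, 0 < inner ℝ ν (y - z) + ε := fun y hy => by
    linarith [hsupp y hy]
  set v := halfSpaceBarrier A B α ε z ν with hv
  have hvb : ∀ y ∈ closure Ω, inner ℝ ν (y - z) + ε ≤ v y ∧ v y ≤ A * (inner ℝ ν (y - z) + ε) :=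
    fun y hy => by
      rw [hv, hA]
      exact halfSpaceBarrier_bounds hB0 (by positivity) hν (hD y hy) hε1 (hs y hy)
  have hvpos : ∀ y ∈ closure Ω, 0 < v y := fun y hy => (hs y hy).trans_le (hvb y hy).1
  have hvc : ContinuousOn v (closure Ω) := by
    have h1 : ContinuousOn (fun y => inner ℝ ν (y - z) + ε) (closure Ω) := by fun_prop
    exact (h1.const_mul A |>.sub ((h1.rpow_const fun y hy => Or.inl (hs y hy).ne').mul
      (by fun_prop)))
  obtain ⟨y₀, hy₀, hmax⟩ := hbd.isCompact_closure.exists_isMaxOn ⟨x, subset_closure hx⟩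
    (hWc.div hvc fun y hy => (hvpos y hy).ne')
  set t := W y₀ / v y₀ with ht
  have hWx : 0 < W x := by
    rw [hW x hx]
    exact inv_pos.mpr (hpos x hx).det_pos
  have htpos : 0 < t :=
    (div_pos hWx (hvpos x (subset_closure hx))).trans_le (hmax (subset_closure hx))
  have hle : ∀ y ∈ closure Ω, W y ≤ t * v y := fun y hy =>
    (div_le_iff₀ (hvpos y hy)).mp (hmax hy)
  have hyΩ : y₀ ∈ Ω := by
    by_contra hn
    have : y₀ ∈ frontier Ω := by rw [hΩ.frontier_eq]; exact ⟨hy₀, hn⟩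
    rw [ht, hW0 y₀ this, zero_div] at htpos
    exact htpos.false
  have hWy : W y₀ = t * v y₀ := by
    rw [ht, div_mul_cancel₀ _ (hvpos y₀ hy₀).ne']
  have hlocal : IsLocalMax (fun y => ((hessianMatrix u y).det)⁻¹ - t * v y) y₀ := by
    filter_upwards [hΩ.mem_nhds hyΩ] with y hy
    rw [← hW y hy, ← hW y₀ hyΩ, hWy]
    linarith [hle y (subset_closure hy)]
  have hC2 : ContDiffAt ℝ 2 (fun y => ((hessianMatrix u y).det)⁻¹) y₀ :=
    (contDiffOn_inv_det_hessianMatrix hΩ hu fun y hy => (hpos y hy).det_pos.ne').contDiffAt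
      (hΩ.mem_nhds hyΩ)
  have htle : t ≤ A ^ m * F ^ (m + 1) := by
    refine barrier_slope_le (hpos y₀ hyΩ) hν (hs y₀ hy₀) htpos.le hA0 (fun ξ => ?_) (hF y₀ hyΩ) ?_
    · refine hessianMatrix_le_of_isLocalMax_sub_barrier hC2 htpos.le hlocal (hs y₀ hy₀) ?_ ?_ ?_
        (hD y₀ hy₀) ξ
      · have : 0 < 1 / (m + 1 : ℝ) := by positivity
        linarith
      · have : 1 / (m + 1 : ℝ) ≤ 1 / 2 := one_div_le_one_div_of_le (by norm_num) hm1
        linarith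
      · rw [hB, hα]
        apply le_of_eq
        field_simp
        ring
    · rw [← hW y₀ hyΩ, hWy]
      exact mul_le_mul_of_nonneg_left (hvb y₀ hy₀).2 htpos.le
  calc ((hessianMatrix u x).det)⁻¹ = W x := (hW x hx).symm
    _ ≤ t * v x := hle x (subset_closure hx)
    _ ≤ (A ^ m * F ^ (m + 1)) * (A * (inner ℝ ν (x - z) + ε)) :=
      mul_le_mul htle (hvb x (subset_closure hx)).2 (hvpos x (subset_closure hx)).le
        (htpos.le.trans htle)
    _ = A ^ (m + 1) * F ^ (m + 1) * (inner ℝ ν (x - z) + ε) := by ring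

/-- Boundary Lipschitz estimate for the inverse of the Hessian
determinant of Abreu's equation `U^{ij} D_{ij} w = -f`, `w = (det D²u)^{-1}`,
with degenerate (zero) boundary data for `w`. -/
theorem stmt_11 (n : ℕ) (hn : 2 ≤ n) (D : ℝ) (hD : 0 < D) :
    ∃ c : ℝ, 0 < c ∧
      ∀ (Ω : Set (EuclideanSpace ℝ (Fin n)))
        (u f : EuclideanSpace ℝ (Fin n) → ℝ) (F : ℝ),
        IsOpen Ω → Bornology.IsBounded Ω → Convex ℝ Ω →
        Metric.diam Ω = D →
        ContDiffOn ℝ 4 u Ω →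
        (∀ x ∈ Ω, (hessianMatrix u x).PosDef) →
        Measurable f →
        (∃ K : ℝ, ∀ x ∈ Ω, |f x| ≤ K) →
        F = sSup ((fun x => max (f x) 0) '' Ω) →
        0 < F →
        (∀ x ∈ Ω, ∑ i, ∑ j,
          ((hessianMatrix u x).det • (hessianMatrix u x)⁻¹) i j *
            hessianMatrix (fun y => ((hessianMatrix u y).det)⁻¹) x i j = -f x) →
        (∃ W : EuclideanSpace ℝ (Fin n) → ℝ, ContinuousOn W (closure Ω) ∧
          (∀ x ∈ Ω, W x = ((hessianMatrix u x).det)⁻¹) ∧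
          (∀ x ∈ frontier Ω, W x = 0)) →
        ∀ x ∈ Ω, (hessianMatrix u x).det ≥
          c * (F ^ n)⁻¹ * (infDist x (frontier Ω))⁻¹ := by
  obtain ⟨m, rfl⟩ := Nat.exists_eq_add_of_le' (show 1 ≤ n by omega)
  have hm : 1 ≤ m := by omega
  obtain ⟨B, hB⟩ : ∃ B : ℝ, B = (m + 1) * (1 + 9 * D ^ 2) := ⟨_, rfl⟩
  obtain ⟨A, hA⟩ : ∃ A : ℝ, A = (D + 1) ^ (1 / (m + 1 : ℝ)) * (B + D ^ 2) + 1 := ⟨_, rfl⟩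
  have hA0 : 0 < A := by
    rw [hA, hB]
    positivity
  refine ⟨(A ^ (m + 1))⁻¹, by positivity, ?_⟩
  rintro Ω u f F hΩ hbd hconv hdiam hu hpos - ⟨K, hK⟩ hFdef hF heq ⟨W, hWc, hW, hW0⟩ x hx
  have hdet : 0 < (hessianMatrix u x).det := (hpos x hx).det_pos
  rcases (frontier Ω).eq_empty_or_nonempty with hfr | hfr
  · simp [hfr, hdet.le]
  have hcpt : IsCompact (frontier Ω) :=
    hbd.isCompact_closure.of_isClosed_subset isClosed_frontier frontier_subset_closure
  obtain ⟨z, hz, hdist⟩ := hcpt.exists_infDist_eq_dist hfr x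
  have hzΩ : z ∉ Ω := by
    rw [hΩ.frontier_eq] at hz
    exact hz.2
  obtain ⟨ν, hν, hsupp⟩ := hconv.exists_unit_supporting_normal hΩ ⟨x, hx⟩ hzΩ
  have hD' : ∀ y ∈ closure Ω, ‖y - z‖ ≤ D := fun y hy => by
    rw [← dist_eq_norm, ← hdiam, ← Metric.diam_closure]
    exact Metric.dist_le_diam_of_mem hbd.closure hy (frontier_subset_closure hz)
  have hfF : ∀ y ∈ Ω, f y ≤ F := fun y hy => by
    rw [hFdef]
    refine (le_max_left _ _).trans (le_csSup ⟨max K 0, ?_⟩ ⟨y, hy, rfl⟩)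
    rintro _ ⟨y', hy', rfl⟩
    exact max_le_max ((le_abs_self _).trans (hK y' hy')) le_rfl
  have hbound : ∀ ε : ℝ, 0 < ε → ε ≤ 1 → ((hessianMatrix u x).det)⁻¹ ≤
      A ^ (m + 1) * F ^ (m + 1) * (inner ℝ ν (x - z) + ε) := fun ε hε hε1 =>
    inv_det_hessianMatrix_le_of_supporting_normal hm hB hA hΩ hbd hu hpos
      (fun y hy => by rw [heq y hy]; linarith [hfF y hy]) hWc hW hW0 hν hsupp hD' hε hε1 hx
  have hlim : ((hessianMatrix u x).det)⁻¹ ≤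
      A ^ (m + 1) * F ^ (m + 1) * (inner ℝ ν (x - z) + 0) := by
    have hc : Continuous fun ε : ℝ => A ^ (m + 1) * F ^ (m + 1) * (inner ℝ ν (x - z) + ε) := by
      fun_prop
    refine ge_of_tendsto ((hc.tendsto 0).mono_left (nhdsWithin_le_nhds (s := Set.Ioi 0))) ?_
    filter_upwards [Ioc_mem_nhdsGT (show (0 : ℝ) < 1 by norm_num)] with ε hε
    exact hbound ε hε.1 hε.2
  have hinner : inner ℝ ν (x - z) ≤ infDist x (frontier Ω) := by
    have := real_inner_le_norm ν (x - z)
    rwa [hν, one_mul, ← dist_eq_norm, ← hdist] at this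
  have hfin : ((hessianMatrix u x).det)⁻¹ ≤
      A ^ (m + 1) * F ^ (m + 1) * infDist x (frontier Ω) := by
    refine hlim.trans ?_
    gcongr
    linarith
  have h := inv_anti₀ (inv_pos.mpr hdet) hfin
  rwa [inv_inv, mul_inv, mul_inv] at h
end
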